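/- arXiv:1011.5200 — 2 statements merged into one kernel-verified Lean document; each statement's English description precedes it below -/
import Mathlib

section
/- For every number of characters c ≥ 1 and every ε > 0 there exists a constant C > 0 (depending only on c and ε) such that the following holds. Let Σ be a finite alphabet, let S ⊆ Σ^c be a set of n ≥ 1 keys, and let m = 2^b satisfy m ≥ (1+ε)·n. Let h₀ and h₁ be two independent random simple tabulation hash functions into m bins. Then the probability that there is no injective map f : S → Fin 2 × (ZMod 2)^b with f(x) ∈ {(0, h₀(x)), (1, h₁(x))} for every x ∈ S (i.e., the probability that cuckoo hashing fails to place S in two tables of size m) is at most C·n^{−1/3}. -/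
open Finset

/-- Simple tabulation hashing. -/
def tabHash {c b : ℕ} {A : Type} (T : Fin c → A → (Fin b → ZMod 2)) (x : Fin c → A) :
    Fin b → ZMod 2 :=
  ∑ i, T i (x i)

/-- Probability over the uniformly random and independent choice of the tables of
two simple tabulation hash functions. -/
noncomputable def tabPr2 (c b : ℕ) (A : Type)
    (P : (Fin c → A → (Fin b → ZMod 2)) → (Fin c → A → (Fin b → ZMod 2)) → Prop) : ℝ :=
  (Nat.card {p : (Fin c → A → (Fin b → ZMod 2)) × (Fin c → A → (Fin b → ZMod 2)) //
      P p.1 p.2} : ℝ) /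
    (Nat.card ((Fin c → A → (Fin b → ZMod 2)) × (Fin c → A → (Fin b → ZMod 2))) : ℝ)

/-- Cuckoo hashing succeeds on `S` with hash functions `h₀, h₁` iff there is an
injective placement of each key at one of its two hash locations. -/
def CuckooSucceeds {c b : ℕ} {A : Type} (S : Finset (Fin c → A))
    (h₀ h₁ : (Fin c → A) → (Fin b → ZMod 2)) : Prop :=
  ∃ f : (Fin c → A) → Fin 2 × (Fin b → ZMod 2),
    Set.InjOn f S ∧ ∀ x ∈ S, f x = (0, h₀ x) ∨ f x = (1, h₁ x)

namespace Ck

abbrev Tab (c b : ℕ) (A : Type) := Fin c → A → (Fin b → ZMod 2)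
abbrev Om (c b : ℕ) (A : Type) := Tab c b A × Tab c b A
abbrev VV (c : ℕ) (A : Type) := Fin c → A → ZMod 2

noncomputable def prob {c b : ℕ} {A : Type} (P : Om c b A → Prop) : ℝ :=
  (Nat.card {p : Om c b A // P p} : ℝ) / (Nat.card (Om c b A) : ℝ)

section probs
variable {c b : ℕ} {A : Type} [Fintype A]

lemma prob_nonneg (P : Om c b A → Prop) : 0 ≤ prob P := by unfold prob; positivity

lemma prob_mono {P Q : Om c b A → Prop} (h : ∀ p, P p → Q p) : prob P ≤ prob Q := by
  classical
  unfold prob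
  gcongr
  exact Nat.card_le_card_of_injective (fun p : {p // P p} => (⟨p.1, h _ p.2⟩ : {p // Q p}))
    (fun a b hab => Subtype.ext (by simpa using hab))

lemma prob_false {P : Om c b A → Prop} (h : ∀ p, ¬ P p) : prob P = 0 := by
  unfold prob
  have : IsEmpty {p // P p} := ⟨fun p => h _ p.2⟩
  simp

lemma prob_or (P Q : Om c b A → Prop) : prob (fun p => P p ∨ Q p) ≤ prob P + prob Q := by
  classical
  unfold prob
  rw [← add_div]
  gcongr
  have := Fintype.card_subtype_or P Q
  simp only [Nat.card_eq_fintype_card]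
  exact_mod_cast this

lemma prob_exists {ι : Type*} (s : Finset ι) (P : ι → Om c b A → Prop) :
    prob (fun p => ∃ i ∈ s, P i p) ≤ ∑ i ∈ s, prob (P i) := by
  classical
  induction s using Finset.induction_on with
  | empty => simp [prob_false]
  | insert a s ha ih =>
    rw [Finset.sum_insert ha]
    refine le_trans (prob_mono (Q := fun p => P a p ∨ ∃ i ∈ s, P i p) ?_) ?_
    · rintro p ⟨i, hi, h⟩
      rcases Finset.mem_insert.1 hi with rfl | hi
      · exact Or.inl h
      · exact Or.inr ⟨i, hi, h⟩
    · exact (prob_or _ _).trans (by gcongr)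

/-- application of a table to a vector -/
def app (T : Tab c b A) (v : VV c A) : Fin b → ZMod 2 := ∑ l, ∑ a, v l a • T l a

def app2 (v : VV c A × VV c A) : Om c b A →+ (Fin b → ZMod 2) where
  toFun p := app p.1 v.1 + app p.2 v.2
  map_zero' := by simp [app]
  map_add' p q := by
    simp only [app, Prod.fst_add, Prod.snd_add, Pi.add_apply, smul_add, Finset.sum_add_distrib]
    abel

lemma prob_lin {ι : Type} [Fintype ι] (v : ι → VV c A × VV c A)
    (hv : LinearIndependent (ZMod 2) v) :
    prob (fun p : Om c b A => ∀ i, app2 (v i) p = 0) = (((2 : ℝ) ^ b)⁻¹) ^ (Fintype.card ι) := by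
  classical
  let Φ : Om c b A →+ (ι → Fin b → ZMod 2) :=
    { toFun := fun p i => app2 (v i) p
      map_zero' := by ext; simp
      map_add' := by intro p q; ext; simp }
  have hsurj : Function.Surjective Φ := by
    intro w
    obtain ⟨F, hF⟩ : ∃ F : (VV c A × VV c A) →ₗ[ZMod 2] (Fin b → ZMod 2), ∀ i, F (v i) = w i := by
      let B := Module.Basis.extend hv.linearIndepOn_id
      have := hv.linearIndepOn_id
      refine ⟨B.constr (ZMod 2) (fun j => if h : ∃ i, v i = j.1 then w h.choose else 0), fun i => ?_⟩
      have hm : v i ∈ hv.linearIndepOn_id.extend (Set.subset_univ _) :=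
        (hv.linearIndepOn_id.subset_extend _) ⟨i, rfl⟩
      have : v i = B ⟨v i, hm⟩ := by simp [B]
      conv_lhs => rw [this]
      rw [Module.Basis.constr_basis]
      have hex : ∃ i', v i' = v i := ⟨i, rfl⟩
      simp only [hex, dite_true]
      congr 1
      exact hv.injective hex.choose_spec
    refine ⟨(fun l a => F (Pi.single l (Pi.single a 1), 0), fun l a => F (0, Pi.single l (Pi.single a 1))), ?_⟩
    ext1 i
    show app _ _ + app _ _ = _
    rw [← hF i]
    have hdec : ∀ u : VV c A, u = ∑ l, ∑ a, u l a • (Pi.single l (Pi.single a 1) : VV c A) := by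
      intro u
      ext l a
      simp only [Finset.sum_apply, Pi.smul_apply]
      rw [Finset.sum_eq_single l, Finset.sum_eq_single a]
      · simp
      · intro a' _ ha'; simp [Pi.single_apply, ha'.symm]
      · simp
      · intro l' _ hl'
        apply Finset.sum_eq_zero; intro a' _
        simp [Pi.single_apply, hl'.symm]
      · simp
    have h1 : ∀ u : VV c A, F (u, 0) = ∑ l, ∑ a, u l a • F (Pi.single l (Pi.single a 1), 0) := by
      intro u
      have := congrArg (F.comp (LinearMap.inl (ZMod 2) (VV c A) (VV c A))) (hdec u)
      simp only [map_sum, map_smul] at this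
      exact this
    have h2 : ∀ u : VV c A, F (0, u) = ∑ l, ∑ a, u l a • F (0, Pi.single l (Pi.single a 1)) := by
      intro u
      have := congrArg (F.comp (LinearMap.inr (ZMod 2) (VV c A) (VV c A))) (hdec u)
      simp only [map_sum, map_smul] at this
      exact this
    unfold app
    rw [← h1, ← h2, ← map_add]
    simp
  have hker : Nat.card {p : Om c b A // ∀ i, app2 (v i) p = 0} = Nat.card Φ.ker := by
    apply Nat.card_congr
    refine Equiv.subtypeEquivRight (fun p => ?_)
    rw [AddMonoidHom.mem_ker]
    exact ⟨fun h => funext h, fun h i => congrFun h i⟩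
  have hcard : Nat.card (Om c b A) = Nat.card (ι → Fin b → ZMod 2) * Nat.card Φ.ker := by
    rw [AddSubgroup.card_eq_card_quotient_mul_card_addSubgroup Φ.ker]
    congr 1
    exact Nat.card_congr (QuotientAddGroup.quotientKerEquivOfSurjective Φ hsurj).toEquiv
  have hc2 : Nat.card (ι → Fin b → ZMod 2) = (2 ^ b) ^ Fintype.card ι := by
    simp [Nat.card_eq_fintype_card, ZMod.card]
  unfold prob
  rw [hker, hcard, hc2]
  have hpos : (0 : ℝ) < Nat.card Φ.ker := by
    have : 0 < Nat.card Φ.ker := Nat.card_pos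
    exact_mod_cast this
  push_cast
  rw [inv_pow]
  field_simp
  
end probs
end Ck

namespace Ck

section lin
variable {c b : ℕ} {A : Type} [Fintype A]

/-- indicator vector of a key -/
noncomputable def ee {c : ℕ} {A : Type} (x : Fin c → A) : VV c A := by
  classical exact fun l a => if a = x l then 1 else 0

lemma tabHash_eq (T : Tab c b A) (x : Fin c → A) : tabHash T x = app T (ee x) := by
  classical
  unfold tabHash app ee
  refine Finset.sum_congr rfl fun l _ => ?_
  simp

def Hs {c b : ℕ} {A : Type} (p : Om c b A) (i : ℕ) (x : Fin c → A) : Fin b → ZMod 2 :=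
  tabHash (if i % 2 = 0 then p.1 else p.2) x

lemma Hs_congr {c b : ℕ} {A : Type} (p : Om c b A) {i j : ℕ} (h : i % 2 = j % 2) : Hs p i = Hs p j := by
  unfold Hs; rw [h]

lemma app_add (T : Tab c b A) (u v : VV c A) : app T (u + v) = app T u + app T v := by
  simp only [app, Pi.add_apply, add_smul, Finset.sum_add_distrib]

lemma app_zero (T : Tab c b A) : app T (0 : VV c A) = 0 := by simp [app]

lemma app_sum {ι : Type*} (T : Tab c b A) (s : Finset ι) (f : ι → VV c A) :
    app T (∑ i ∈ s, f i) = ∑ i ∈ s, app T (f i) := by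
  classical
  induction s using Finset.induction_on with
  | empty => simp [app_zero]
  | insert a s ha ih => rw [sum_insert ha, sum_insert ha, app_add, ih]

def inS {c : ℕ} {A : Type} (i : ℕ) (v : VV c A) : VV c A × VV c A := if i % 2 = 0 then (v, 0) else (0, v)

lemma app2_inS (p : Om c b A) (i : ℕ) (v : VV c A) :
    app2 (inS i v) p = app (if i % 2 = 0 then p.1 else p.2) v := by
  unfold inS
  split_ifs <;> simp [app2, app_zero]

def prS (c : ℕ) (A : Type) (i : ℕ) : (VV c A × VV c A) →ₗ[ZMod 2] VV c A :=
  if i % 2 = 0 then LinearMap.fst _ _ _ else LinearMap.snd _ _ _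

lemma prS_inS {c : ℕ} {A : Type} (i j : ℕ) (v : VV c A) :
    prS c A i (inS j v) = if i % 2 = j % 2 then v else 0 := by
  unfold prS inS
  rcases Nat.mod_two_eq_zero_or_one i with h | h <;>
  rcases Nat.mod_two_eq_zero_or_one j with h' | h' <;> simp [h, h']

lemma tri_indep {ι : Type} [Fintype ι] {W : Type} [AddCommGroup W] [Module (ZMod 2) W]
    (v : ι → W) (F : ι → W →ₗ[ZMod 2] ZMod 2) (ρ : ι → ℕ) (hρ : Function.Injective ρ)
    (h1 : ∀ r, F r (v r) = 1) (h0 : ∀ r s, ρ s < ρ r → F r (v s) = 0) :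
    LinearIndependent (ZMod 2) v := by
  classical
  rw [Fintype.linearIndependent_iff]
  intro g hg
  by_contra hne
  push Not at hne
  obtain ⟨i, hi⟩ := hne
  obtain ⟨r, hr, hmax⟩ := Finset.exists_max_image (univ.filter fun i => g i ≠ 0) ρ ⟨i, by simp [hi]⟩
  have hr' : g r ≠ 0 := by simpa using hr
  have := congrArg (F r) hg
  rw [map_sum, map_zero, Finset.sum_eq_single r] at this
  · simp [h1] at this; exact hr' this
  · intro s _ hs
    by_cases hgs : g s = 0
    · simp [hgs]
    · have := hmax s (by simp [hgs])
      have hlt : ρ s < ρ r := lt_of_le_of_ne this (fun h => hs (hρ h))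
      simp [h0 r s hlt]
  · simp

/-- independence of keys on an interval of positions -/
def Ind {c : ℕ} {A : Type} (x : ℕ → Fin c → A) (lo hi : ℕ) : Prop :=
  ∀ w : Finset ℕ, w ⊆ Finset.Ico lo hi → ∑ i ∈ w, ee (x i) = 0 → w = ∅

lemma exists_functional {x : ℕ → Fin c → A} {lo hi : ℕ} (h : Ind x lo hi) (g : ℕ → ZMod 2) :
    ∃ F : VV c A →ₗ[ZMod 2] ZMod 2, ∀ i, lo ≤ i → i < hi → F (ee (x i)) = g i := by
  classical
  have hv : LinearIndependent (ZMod 2) (fun i : Finset.Ico lo hi => ee (x i)) := by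
    rw [Fintype.linearIndependent_iff]
    intro f hf i
    have hz2 : ∀ z : ZMod 2, z = 0 ∨ z = 1 := by decide
    by_contra hi0
    have key := h ((univ.filter fun j : Finset.Ico lo hi => f j ≠ 0).map ⟨Subtype.val, Subtype.val_injective⟩) ?_ ?_
    · rw [Finset.map_eq_empty] at key
      have : i ∈ (univ.filter fun j : Finset.Ico lo hi => f j ≠ 0) := by simp [hi0]
      rw [key] at this; simp at this
    · intro j hj
      simp only [Finset.mem_map, Function.Embedding.coeFn_mk] at hj
      obtain ⟨a, _, rfl⟩ := hj
      exact a.2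
    · rw [Finset.sum_map, Finset.sum_filter]
      refine Eq.trans (Finset.sum_congr rfl fun j _ => ?_) hf
      rcases hz2 (f j) with h | h <;> simp [h]
  let B := Module.Basis.extend hv.linearIndepOn_id
  refine ⟨B.constr (ZMod 2) (fun j => if h : ∃ i : Finset.Ico lo hi, ee (x i) = j.1 then g h.choose.1 else 0), fun i h1 h2 => ?_⟩
  have hm : ee (x i) ∈ hv.linearIndepOn_id.extend (Set.subset_univ _) :=
    (hv.linearIndepOn_id.subset_extend _) ⟨⟨i, Finset.mem_Ico.2 ⟨h1, h2⟩⟩, rfl⟩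
  have : ee (x i) = B ⟨ee (x i), hm⟩ := by simp [B]
  conv_lhs => rw [this]
  rw [Module.Basis.constr_basis]
  have hex : ∃ i' : Finset.Ico lo hi, ee (x i') = ee (x i) := ⟨⟨i, Finset.mem_Ico.2 ⟨h1, h2⟩⟩, rfl⟩
  simp only [hex, dite_true]
  have := hv.injective (a₁ := hex.choose) (a₂ := ⟨i, Finset.mem_Ico.2 ⟨h1, h2⟩⟩) hex.choose_spec
  rw [this]

def Det {c : ℕ} {A : Type} (x : ℕ → Fin c → A) (lo hi σ X : ℕ) (V : Fin X → Fin 4 → ℕ) (τ : Fin X → ℕ) : Prop :=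
  Ind x lo hi ∧ ∃ g : Fin X → ℕ → ZMod 2, ∀ r, (∀ k, lo ≤ V r k ∧ V r k < hi) ∧ ∑ k, g r (V r k) = 1 ∧
    (∀ i, lo ≤ i → i + 1 < hi → (σ + i) % 2 = τ r % 2 → g r i = g r (i + 1)) ∧
    ∀ r' < r, τ r' % 2 = τ r % 2 → ∑ k, g r (V r' k) = 0

def Ran {c b : ℕ} {A : Type} (p : Om c b A) (x : ℕ → Fin c → A) (lo hi σ X : ℕ)
    (V : Fin X → Fin 4 → ℕ) (τ : Fin X → ℕ) : Prop :=
  (∀ i, lo ≤ i → i + 1 < hi → Hs p (σ + i) (x i) = Hs p (σ + i) (x (i + 1))) ∧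
  ∀ r, ∑ k, Hs p (τ r) (x (V r k)) = 0

lemma Hs_app2 (p : Om c b A) (i : ℕ) (x : Fin c → A) : Hs p i x = app2 (inS i (ee x)) p := by
  rw [app2_inS, Hs, tabHash_eq]

lemma vadd_self {b : ℕ} (v : Fin b → ZMod 2) : v + v = 0 := by
  ext i; exact CharTwo.add_self_eq_zero _

lemma prob_ran {x : ℕ → Fin c → A} {lo hi σ X : ℕ} {V : Fin X → Fin 4 → ℕ} {τ : Fin X → ℕ}
    (h : Det x lo hi σ X V τ) :
    prob (fun p : Om c b A => Ran p x lo hi σ X V τ) ≤ (((2 : ℝ) ^ b)⁻¹) ^ ((hi - lo - 1) + X) := by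
  classical
  obtain ⟨hI, g, hg⟩ := h
  choose G hG using fun r => exists_functional hI (g r)
  choose D hD using fun j => exists_functional hI (fun i => if i = j then 1 else 0)
  let v : Fin (hi - lo - 1) ⊕ Fin X → VV c A × VV c A := Sum.elim
    (fun i => inS (σ + (lo + i)) (ee (x (lo + i)) + ee (x (lo + i + 1))))
    (fun r => inS (τ r) (∑ k, ee (x (V r k))))
  let F : Fin (hi - lo - 1) ⊕ Fin X → (VV c A × VV c A) →ₗ[ZMod 2] ZMod 2 := Sum.elim
    (fun i => (D (lo + i + 1)).comp (prS c A (σ + (lo + i))))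
    (fun r => (G r).comp (prS c A (τ r)))
  let ρ : Fin (hi - lo - 1) ⊕ Fin X → ℕ := Sum.elim (fun i => i) (fun r => (hi - lo - 1) + r)
  have hv : LinearIndependent (ZMod 2) v := by
    refine tri_indep v F ρ ?_ ?_ ?_
    · rintro (i | i) (j | j) hij <;> simp only [ρ, Sum.elim_inl, Sum.elim_inr] at hij
      · rw [Fin.ext hij]
      · have := i.2; omega
      · have := j.2; omega
      · have : i = j := Fin.ext (by omega)
        rw [this]
    · rintro (i | r)
      · have := i.2
        simp only [v, F, Sum.elim_inl, LinearMap.comp_apply, prS_inS, if_true, map_add]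
        rw [hD _ _ (by omega) (by omega), hD _ _ (by omega) (by omega)]
        simp
      · simp only [v, F, Sum.elim_inr, LinearMap.comp_apply, prS_inS, if_true, map_sum]
        rw [← (hg r).2.1]
        exact Finset.sum_congr rfl fun k _ => hG r _ ((hg r).1 k).1 ((hg r).1 k).2
    · rintro (i | r) (j | s) hlt <;> simp only [ρ, Sum.elim_inl, Sum.elim_inr] at hlt
      · have := i.2
        simp only [v, F, Sum.elim_inl, LinearMap.comp_apply, prS_inS]
        split_ifs
        · rw [map_add, hD _ _ (by omega) (by omega), hD _ _ (by omega) (by omega)]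
          rw [if_neg (by omega), if_neg (by omega)]; simp
        · simp
      · have := i.2; omega
      · have := j.2
        simp only [v, F, Sum.elim_inl, Sum.elim_inr, LinearMap.comp_apply, prS_inS]
        split_ifs with hs
        · rw [map_add, hG r _ (by omega) (by omega), hG r _ (by omega) (by omega),
            (hg r).2.2.1 (lo + j) (by omega) (by omega) hs.symm]
          exact CharTwo.add_self_eq_zero _
        · simp
      · simp only [v, F, Sum.elim_inr, LinearMap.comp_apply, prS_inS]
        split_ifs with hs
        · rw [map_sum, ← (hg r).2.2.2 s (by rw [Fin.lt_def]; omega) hs.symm]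
          exact Finset.sum_congr rfl fun k _ => hG r _ ((hg s).1 k).1 ((hg s).1 k).2
        · simp
  have := prob_lin (b := b) v hv
  rw [Fintype.card_sum, Fintype.card_fin, Fintype.card_fin] at this
  rw [← this]
  apply prob_mono
  rintro p ⟨hp, he⟩ (i | r)
  · have := i.2
    have h := hp (lo + i) (by omega) (by omega)
    simp only [v, Sum.elim_inl]
    rw [app2_inS, app_add, ← tabHash_eq, ← tabHash_eq]
    change Hs p _ _ + Hs p _ _ = 0
    rw [h, vadd_self]
  · simp only [v, Sum.elim_inr]
    rw [app2_inS, app_sum, ← he r]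
    exact Finset.sum_congr rfl fun k _ => by rw [← tabHash_eq]; rfl

end lin
end Ck

namespace Ck

section holder
variable {A : Type} [Fintype A]

noncomputable def NN {B : Type} [Fintype B] (P : Prop) (f : B → ℝ) : ℝ := by
  classical exact if P then Real.sqrt (∑ x, f x ^ 2) else ∑ x, f x

lemma NN_nonneg {B : Type} [Fintype B] (P : Prop) (f : B → ℝ) (hf : ∀ x, 0 ≤ f x) : 0 ≤ NN P f := by
  unfold NN; split_ifs
  · positivity
  · exact Finset.sum_nonneg fun x _ => hf x

lemma sqrt_le_NN {B : Type} [Fintype B] (P : Prop) (f : B → ℝ) (hf : ∀ x, 0 ≤ f x) :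
    Real.sqrt (∑ x, f x ^ 2) ≤ NN P f := by
  unfold NN; split_ifs
  · exact le_rfl
  · apply Real.sqrt_le_iff.2 ⟨Finset.sum_nonneg fun x _ => hf x, ?_⟩
    exact Finset.sum_sq_le_sq_sum_of_nonneg (fun x _ => hf x)

lemma le_NN {B : Type} [Fintype B] (P : Prop) (f : B → ℝ) (hf : ∀ x, 0 ≤ f x) (x : B) :
    f x ≤ NN P f := by
  refine le_trans ?_ (sqrt_le_NN P f hf)
  apply Real.le_sqrt_of_sq_le
  exact Finset.single_le_sum (f := fun x => f x ^ 2) (fun i _ => sq_nonneg _) (mem_univ x)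

lemma fiber_bound {J : Type} (M : Finset J) (T : Finset J) (hT : T.Nonempty)
    (hM : ∀ i ∈ T, i ∈ M → ∃ i' ∈ T, i' ≠ i) (g : J → A → ℝ) (hg : ∀ i a, 0 ≤ g i a) :
    ∑ a, ∏ i ∈ T, g i a ≤ ∏ i ∈ T, NN (i ∈ M) (g i) := by
  classical
  obtain ⟨i0, h0⟩ := hT
  by_cases h : ∃ i1 ∈ T, i1 ≠ i0
  · obtain ⟨i1, h1, hne⟩ := h
    have h1' : i1 ∈ T.erase i0 := Finset.mem_erase.2 ⟨hne, h1⟩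
    have hsplit : ∀ G : J → ℝ, ∏ i ∈ T, G i = G i0 * G i1 * ∏ i ∈ (T.erase i0).erase i1, G i := by
      intro G
      rw [← Finset.mul_prod_erase T G h0, ← Finset.mul_prod_erase _ G h1', mul_assoc]
    simp only [hsplit]
    have hR : 0 ≤ ∏ i ∈ (T.erase i0).erase i1, NN (i ∈ M) (g i) :=
      Finset.prod_nonneg fun i _ => NN_nonneg _ _ (hg i)
    calc ∑ a, g i0 a * g i1 a * ∏ i ∈ (T.erase i0).erase i1, g i a
        ≤ ∑ a, g i0 a * g i1 a * ∏ i ∈ (T.erase i0).erase i1, NN (i ∈ M) (g i) := by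
          apply Finset.sum_le_sum; intro a _
          apply mul_le_mul_of_nonneg_left
          · exact Finset.prod_le_prod (fun i _ => hg i a) (fun i _ => le_NN _ _ (hg i) a)
          · exact mul_nonneg (hg _ _) (hg _ _)
      _ = (∑ a, g i0 a * g i1 a) * ∏ i ∈ (T.erase i0).erase i1, NN (i ∈ M) (g i) := by
          rw [Finset.sum_mul]
      _ ≤ _ := by
          apply mul_le_mul_of_nonneg_right _ hR
          refine (Real.sum_mul_le_sqrt_mul_sqrt _ _ _).trans ?_
          exact mul_le_mul (sqrt_le_NN _ _ (hg _)) (sqrt_le_NN _ _ (hg _)) (Real.sqrt_nonneg _)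
            (NN_nonneg _ _ (hg _))
  · push Not at h
    have hT1 : T = {i0} := by
      ext i; simp only [Finset.mem_singleton]
      exact ⟨fun hi => h i hi, fun hi => hi ▸ h0⟩
    have hi0 : i0 ∉ M := by
      intro hi
      obtain ⟨i', hi', hne⟩ := hM i0 h0 hi
      exact hne (h i' hi')
    rw [hT1]
    simp only [Finset.prod_singleton]
    unfold NN
    rw [if_neg hi0]

open Classical in
lemma one_coord {J : Type} [Fintype J] (r : J → J → Prop) (M : Finset J)
    (hM : ∀ i ∈ M, ∃ i', i' ≠ i ∧ r i i') (g : J → A → ℝ) (hg : ∀ i a, 0 ≤ g i a) :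
    ∑ v : J → A, (if ∀ i i', r i i' → v i = v i' then ∏ i, g i (v i) else 0)
      ≤ ∏ i, NN (i ∈ M) (g i) := by
  have : Fintype (Quot r) := Fintype.ofFinite _
  rw [← Finset.sum_filter]
  have h1 : ∑ v ∈ univ.filter (fun v : J → A => ∀ i i', r i i' → v i = v i'), ∏ i, g i (v i)
      = ∑ u : Quot r → A, ∏ i, g i (u (Quot.mk r i)) := by
    symm
    refine Finset.sum_bij (fun u _ => fun i => u (Quot.mk r i)) ?_ ?_ ?_ ?_
    · intro u _
      simp only [Finset.mem_filter, Finset.mem_univ, true_and]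
      intro i i' h
      rw [Quot.sound h]
    · intro u _ u' _ h
      ext q
      induction q using Quot.ind with
      | mk i => exact congrFun h i
    · intro v hv
      simp only [Finset.mem_filter, Finset.mem_univ, true_and] at hv
      exact ⟨Quot.lift v hv, mem_univ _, rfl⟩
    · intro u _; rfl
  rw [h1]
  have h2 : ∀ G : J → ℝ, ∏ q : Quot r, ∏ i ∈ univ.filter (fun i => Quot.mk r i = q), G i = ∏ i, G i :=
    fun G => Finset.prod_fiberwise _ _ _
  calc ∑ u : Quot r → A, ∏ i, g i (u (Quot.mk r i))
      = ∑ u : Quot r → A, ∏ q : Quot r, ∏ i ∈ univ.filter (fun i => Quot.mk r i = q), g i (u q) := by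
        apply Finset.sum_congr rfl; intro u _
        rw [← h2]
        apply Finset.prod_congr rfl; intro q _
        apply Finset.prod_congr rfl; intro i hi
        rw [(Finset.mem_filter.1 hi).2]
    _ = ∏ q : Quot r, ∑ a, ∏ i ∈ univ.filter (fun i => Quot.mk r i = q), g i a := by
        rw [Finset.prod_univ_sum]; simp
    _ ≤ ∏ q : Quot r, ∏ i ∈ univ.filter (fun i => Quot.mk r i = q), NN (i ∈ M) (g i) := by
        apply Finset.prod_le_prod
        · intro q _
          exact Finset.sum_nonneg fun a _ => Finset.prod_nonneg fun i _ => hg i a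
        · intro q _
          apply fiber_bound M _ _ _ g hg
          · induction q using Quot.ind with
            | mk i => exact ⟨i, by simp⟩
          · intro i hi hiM
            obtain ⟨i', hne, hr⟩ := hM i hiM
            refine ⟨i', ?_, hne⟩
            simp only [Finset.mem_filter, Finset.mem_univ, true_and] at hi ⊢
            rw [← hi]; exact (Quot.sound hr).symm
    _ = _ := h2 _

open Classical in
lemma holder_cnt (c : ℕ) {J : Type} [Fintype J] (r : Fin c → J → J → Prop) (M : Finset J)
    (hM : ∀ l, ∀ i ∈ M, ∃ i', i' ≠ i ∧ r l i i') (f : J → (Fin c → A) → ℝ) (hf : ∀ i x, 0 ≤ f i x) :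
    ∑ y : J → Fin c → A, (if ∀ l i i', r l i i' → y i l = y i' l then ∏ i, f i (y i) else 0)
      ≤ ∏ i, NN (i ∈ M) (f i) := by
  induction c with
  | zero =>
    rw [Fintype.sum_unique]
    simp only [IsEmpty.forall_iff, if_true]
    apply Finset.prod_le_prod
    · intro i _; exact hf _ _
    · intro i _; exact le_NN _ _ (hf i) _
  | succ c ih =>
    let E : (J → A) × (J → Fin c → A) ≃ (J → Fin (c + 1) → A) :=
      { toFun := fun vz i => Fin.cons (vz.1 i) (vz.2 i)
        invFun := fun y => (fun i => y i 0, fun i => Fin.tail (y i))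
        left_inv := by intro vz; simp
        right_inv := by intro y; ext i; simp }
    rw [← E.sum_comp, Fintype.sum_prod_type]
    have hnn : ∀ i a, 0 ≤ NN (i ∈ M) (fun z : Fin c → A => f i (Fin.cons a z)) :=
      fun i a => NN_nonneg _ _ (fun z => hf _ _)
    have hone := one_coord (r 0) M (hM 0) (fun i a => NN (i ∈ M) (fun z : Fin c → A => f i (Fin.cons a z))) hnn
    have heq : ∀ i, NN (i ∈ M) (fun a => NN (i ∈ M) (fun z : Fin c → A => f i (Fin.cons a z)))
        = NN (i ∈ M) (f i) := by
      intro i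
      have hs : ∀ G : (Fin (c + 1) → A) → ℝ, ∑ x, G x = ∑ a, ∑ z : Fin c → A, G (Fin.cons a z) := by
        intro G
        rw [← (Fin.consEquiv (fun _ => A)).sum_comp, Fintype.sum_prod_type]
        rfl
      unfold NN
      split_ifs
      · rw [hs]
        congr 1
        apply Finset.sum_congr rfl; intro a _
        rw [Real.sq_sqrt]
        positivity
      · rw [hs]
    simp only [heq] at hone
    refine le_trans (Finset.sum_le_sum fun v _ => ?_) hone
    by_cases hv : ∀ i i', r 0 i i' → v i = v i'
    · rw [if_pos hv]
      refine le_trans (Finset.sum_le_sum fun z _ => ?_)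
        (ih (fun l => r l.succ) (fun l => hM l.succ) (fun i z => f i (Fin.cons (v i) z)) (fun i z => hf _ _))
      split_ifs with h1 h2
      · exact le_rfl
      · exact absurd (fun l i i' h => by simpa [E] using h1 l.succ i i' h) h2
      · exact Finset.prod_nonneg fun i _ => hf _ _
      · exact le_rfl
    · rw [if_neg hv]
      apply le_of_eq
      apply Finset.sum_eq_zero
      intro z _
      rw [if_neg]
      intro h
      exact hv fun i i' hr => by simpa [E] using h 0 i i' hr

open Classical in
lemma count_rel {c : ℕ} {J : Type} [Fintype J] (S : Finset (Fin c → A)) (r : Fin c → J → J → Prop)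
    (M : Finset J) (hM : ∀ l, ∀ i ∈ M, ∃ i', i' ≠ i ∧ r l i i') :
    (((Fintype.piFinset fun _ : J => S).filter
      (fun y => ∀ l i i', r l i i' → y i l = y i' l)).card : ℝ) * (Real.sqrt S.card) ^ M.card
      ≤ (S.card : ℝ) ^ (Fintype.card J) := by
  have h := holder_cnt c r M hM (fun _ x => if x ∈ S then (1 : ℝ) else 0)
    (fun _ _ => by split_ifs <;> norm_num)
  have hl : (((Fintype.piFinset fun _ : J => S).filter
      (fun y => ∀ l i i', r l i i' → y i l = y i' l)).card : ℝ) =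
      ∑ y : J → Fin c → A, (if ∀ l i i', r l i i' → y i l = y i' l then
        ∏ i, (if y i ∈ S then (1 : ℝ) else 0) else 0) := by
    rw [Finset.card_filter, Nat.cast_sum, ← Finset.sum_subset (Finset.subset_univ (Fintype.piFinset fun _ : J => S))]
    · apply Finset.sum_congr rfl
      intro y hy
      have : ∏ i, (if y i ∈ S then (1 : ℝ) else 0) = 1 :=
        Finset.prod_eq_one fun i _ => if_pos (Fintype.mem_piFinset.1 hy i)
      rw [this]; push_cast; rfl
    · intro y _ hy
      rw [Fintype.mem_piFinset] at hy
      push Not at hy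
      obtain ⟨i, hi⟩ := hy
      have : ∏ i, (if y i ∈ S then (1 : ℝ) else 0) = 0 :=
        Finset.prod_eq_zero (mem_univ i) (if_neg hi)
      rw [this]; simp
  rw [hl]
  have hN : ∀ i, NN (i ∈ M) (fun x : Fin c → A => if x ∈ S then (1 : ℝ) else 0) =
      if i ∈ M then Real.sqrt S.card else S.card := by
    intro i
    unfold NN
    simp
  simp only [hN] at h
  calc _ ≤ (∏ i : J, if i ∈ M then Real.sqrt S.card else (S.card : ℝ)) * (Real.sqrt S.card) ^ M.card := by
        gcongr
    _ = (∏ i : J, if i ∈ M then Real.sqrt S.card else (S.card : ℝ)) * ∏ i : J, (if i ∈ M then Real.sqrt S.card else 1) := by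
        congr 1
        rw [Finset.prod_ite]; simp
    _ = ∏ i : J, (S.card : ℝ) := by
        rw [← Finset.prod_mul_distrib]
        apply Finset.prod_congr rfl; intro i _
        split_ifs
        · exact Real.mul_self_sqrt (by positivity)
        · simp
    _ = _ := by simp

/-- at least `μ` positions are covered in every coordinate by another position -/
def Cov {c : ℕ} {A : Type} (μ : ℕ) {N : ℕ} (y : Fin N → Fin c → A) : Prop :=
  ∃ m : Fin μ → Fin N, Function.Injective m ∧ ∀ k l, ∃ i, i ≠ m k ∧ y i l = y (m k) l

open Classical in
lemma count_cov {c : ℕ} (S : Finset (Fin c → A)) (μ N : ℕ) :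
    (((Fintype.piFinset fun _ : Fin N => S).filter (fun y => Cov μ y)).card : ℝ) * (Real.sqrt S.card) ^ μ
      ≤ (N : ℝ) ^ (μ + c * μ) * (S.card : ℝ) ^ N := by
  set Ix := (Fin μ → Fin N) × (Fin μ → Fin c → Fin N)
  let B : Ix → Finset (Fin N → Fin c → A) := fun mp =>
    if Function.Injective mp.1 ∧ ∀ k l, mp.2 k l ≠ mp.1 k then
    (Fintype.piFinset fun _ : Fin N => S).filter
      (fun y => ∀ l i i', (∃ k, i = mp.1 k ∧ i' = mp.2 k l) → y i l = y i' l) else ∅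
  have hsub : (Fintype.piFinset fun _ : Fin N => S).filter (fun y => Cov μ y) ⊆ univ.biUnion B := by
    intro y hy
    rw [Finset.mem_filter] at hy
    obtain ⟨hy, m, hm, h⟩ := hy
    choose π h1 h2 using h
    simp only [Finset.mem_biUnion, Finset.mem_univ, true_and]
    refine ⟨(m, π), ?_⟩
    simp only [B]
    rw [if_pos ⟨hm, h1⟩, Finset.mem_filter]
    refine ⟨hy, ?_⟩
    rintro l i i' ⟨k, rfl, rfl⟩
    exact (h2 k l).symm
  have hB : ∀ mp, ((B mp).card : ℝ) * (Real.sqrt S.card) ^ μ ≤ (S.card : ℝ) ^ N := by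
    intro mp
    simp only [B]
    split_ifs with h
    · have := count_rel S (fun l i i' => ∃ k, i = mp.1 k ∧ i' = mp.2 k l) (univ.image mp.1) (by
        intro l i hi
        obtain ⟨k, _, rfl⟩ := Finset.mem_image.1 hi
        exact ⟨_, h.2 k l, k, rfl, rfl⟩)
      rw [Finset.card_image_of_injective _ h.1, Finset.card_univ, Fintype.card_fin, Fintype.card_fin] at this
      convert this
    · simp
  calc _ ≤ ((univ.biUnion B).card : ℝ) * (Real.sqrt S.card) ^ μ := by
        gcongr
    _ ≤ (∑ mp, ((B mp).card : ℝ)) * (Real.sqrt S.card) ^ μ := by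
        gcongr
        exact_mod_cast Finset.card_biUnion_le
    _ = ∑ mp, ((B mp).card : ℝ) * (Real.sqrt S.card) ^ μ := by rw [Finset.sum_mul]
    _ ≤ ∑ mp : Ix, (S.card : ℝ) ^ N := Finset.sum_le_sum fun mp _ => hB mp
    _ = _ := by
        rw [Finset.sum_const, nsmul_eq_mul, Finset.card_univ]
        congr 1
        simp only [Ix, Fintype.card_prod, Fintype.card_fun, Fintype.card_fin]
        push_cast
        rw [pow_add, pow_mul]

end holder

section zs
variable {c : ℕ} {A : Type}

lemma ee_inj : Function.Injective (ee : (Fin c → A) → VV c A) := by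
  classical
  intro x y h
  ext l
  have := congrFun (congrFun h l) (x l)
  unfold ee at this
  by_contra hne
  simp [hne] at this

lemma zs_cover {ι : Type} (w : Finset ι) (y : ι → Fin c → A) (hw : ∑ j ∈ w, ee (y j) = 0)
    {i : ι} (hi : i ∈ w) (l : Fin c) : ∃ j ∈ w, j ≠ i ∧ y j l = y i l := by
  classical
  by_contra hne
  push Not at hne
  have := congrFun (congrFun hw l) (y i l)
  rw [Finset.sum_apply, Finset.sum_apply, Finset.sum_eq_single i] at this
  · simp [ee] at this
  · intro j hj hji
    have := hne j hj hji
    simp [ee, this.symm]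
  · exact fun h => absurd hi h

lemma zs_even (hc : 1 ≤ c) {ι : Type} (w : Finset ι) (y : ι → Fin c → A) [Fintype A]
    (hw : ∑ j ∈ w, ee (y j) = 0) : Even w.card := by
  classical
  have h := congrFun hw ⟨0, hc⟩
  rw [Finset.sum_apply] at h
  have h2 : ∑ a, (∑ j ∈ w, ee (y j) ⟨0, hc⟩) a = 0 := by rw [h]; simp
  simp only [Finset.sum_apply] at h2
  rw [Finset.sum_comm] at h2
  have h3 : ∀ j, ∑ a, ee (y j) ⟨0, hc⟩ a = 1 := by
    intro j; simp [ee]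
  simp only [h3, Finset.sum_const, nsmul_eq_mul, mul_one] at h2
  exact (ZMod.natCast_eq_zero_iff_even).1 h2

/-- number of representations -/
noncomputable def rr (S : Finset (Fin c → A)) (d : VV c A) : ℕ := by
  classical exact ((S ×ˢ S).filter (fun u => ee u.1 + ee u.2 = d)).card

lemma vv_add_self (v : VV c A) : v + v = 0 := by
  ext l a; exact CharTwo.add_self_eq_zero _

lemma vv_eq_iff (u v : VV c A) : u + v = 0 ↔ u = v := by
  constructor
  · intro h
    have : u + v + v = v := by rw [h, zero_add]
    rwa [add_assoc, vv_add_self, add_zero] at this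
  · rintro rfl; exact vv_add_self _

variable [Fintype A]
open Classical in
lemma count_quad (S : Finset (Fin c → A)) (hS : 1 ≤ S.card) :
    (((Fintype.piFinset fun _ : Fin 4 => S).filter
      (fun y => ee (y 0) + ee (y 1) = ee (y 2) + ee (y 3))).card : ℝ) ≤ 4 ^ (4 + c * 4) * (S.card : ℝ) ^ 2 := by
  have h := count_cov S 4 4
  have hs : (Real.sqrt S.card) ^ 4 = (S.card : ℝ) ^ 2 := by
    rw [show 4 = 2 * 2 from rfl, pow_mul, Real.sq_sqrt (by positivity)]
  have hsub : (Fintype.piFinset fun _ : Fin 4 => S).filter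
      (fun y => ee (y 0) + ee (y 1) = ee (y 2) + ee (y 3)) ⊆
      (Fintype.piFinset fun _ : Fin 4 => S).filter (fun y => Cov 4 y) := by
    intro y hy
    rw [Finset.mem_filter] at hy ⊢
    refine ⟨hy.1, id, fun _ _ h => h, fun k l => ?_⟩
    have h0 : ∑ j, ee (y j) = 0 := by
      rw [Fin.sum_univ_four, hy.2, add_assoc, vv_add_self]
    obtain ⟨j, _, h1, h2⟩ := zs_cover univ y h0 (mem_univ k) l
    exact ⟨j, h1, h2⟩
  have hn : (0 : ℝ) < (S.card : ℝ) ^ 2 := by positivity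
  rw [hs] at h
  have h' : (((Fintype.piFinset fun _ : Fin 4 => S).filter
      (fun y => ee (y 0) + ee (y 1) = ee (y 2) + ee (y 3))).card : ℝ) ≤ 
      ((Fintype.piFinset fun _ : Fin 4 => S).filter (fun y => Cov 4 y)).card := by
    exact_mod_cast Finset.card_le_card hsub
  have h3 := (mul_le_mul_of_nonneg_right h' hn.le).trans h
  have h4 : (S.card : ℝ) ^ 4 = (S.card : ℝ) ^ 2 * (S.card : ℝ) ^ 2 := by ring
  rw [h4, ← mul_assoc] at h3
  exact_mod_cast le_of_mul_le_mul_right h3 hn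

open Classical in
lemma count_ext {B : Type} (S : Finset B) {k N : ℕ} (m : Fin k → Fin N) (hm : Function.Injective m)
    (P : (Fin k → B) → Prop) :
    (((Fintype.piFinset fun _ : Fin N => S).filter (fun y => P (y ∘ m))).card : ℝ) * (S.card : ℝ) ^ k ≤
     ((Fintype.piFinset fun _ : Fin k => S).filter P).card * (S.card : ℝ) ^ N := by
  have hle : ((Fintype.piFinset fun _ : Fin N => S).filter (fun y => P (y ∘ m))).card ≤
      (((Fintype.piFinset fun _ : Fin k => S).filter P) ×ˢ
        (Fintype.piFinset fun _ : {i // i ∉ Set.range m} => S)).card := by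
    apply Finset.card_le_card_of_injOn (fun y => (y ∘ m, fun i => y i.1))
    · intro y hy
      simp only [Finset.coe_filter, Set.mem_ofPred_eq, Fintype.mem_piFinset] at hy
      simp only [Finset.coe_product, Set.mem_prod, Finset.mem_coe, Finset.mem_filter,
        Fintype.mem_piFinset, Function.comp]
      exact ⟨⟨fun i => hy.1 _, hy.2⟩, fun i => hy.1 _⟩
    · intro y _ y' _ h
      simp only [Prod.mk.injEq] at h
      ext i
      by_cases hi : i ∈ Set.range m
      · obtain ⟨j, rfl⟩ := hi
        exact congrFun h.1 j
      · exact congrFun h.2 ⟨i, hi⟩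
  have hcard : Fintype.card {i // i ∉ Set.range m} + k = N := by
    have h1 := Fintype.card_subtype_compl (fun i => i ∈ Set.range m)
    have h2 : Fintype.card {i // i ∈ Set.range m} = k := by
      have h5 := Fintype.card_congr (Equiv.ofInjective m hm)
      rw [Fintype.card_fin] at h5
      exact (Fintype.card_congr (Equiv.refl _)).trans h5.symm
    have h3 : k ≤ N := by simpa using Fintype.card_le_of_injective m hm
    have h4 : Fintype.card (Fin N) = N := Fintype.card_fin N
    omega
  rw [Finset.card_product, Fintype.card_piFinset, Finset.prod_const, Finset.card_univ] at hle
  have hle' : (((Fintype.piFinset fun _ : Fin N => S).filter (fun y => P (y ∘ m))).card : ℝ) ≤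
    ((Fintype.piFinset fun _ : Fin k => S).filter P).card * (S.card : ℝ) ^ (Fintype.card {i // i ∉ Set.range m}) := by
    exact_mod_cast hle
  calc _ ≤ ((Fintype.piFinset fun _ : Fin k => S).filter P).card * (S.card : ℝ) ^ (Fintype.card {i // i ∉ Set.range m}) * (S.card : ℝ) ^ k := by gcongr
    _ = _ := by rw [mul_assoc, ← pow_add, hcard]

/-- the three-pairs pattern -/
def P6 (S : Finset (Fin c → A)) (u : Fin 6 → Fin c → A) : Prop :=
  ee (u 0) + ee (u 1) = ee (u 2) + ee (u 3) ∧ ee (u 4) + ee (u 5) = ee (u 2) + ee (u 3) ∧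
    ((rr S (ee (u 2) + ee (u 3)) : ℕ) : ℝ) ≤ (S.card : ℝ) ^ (2 / 3 : ℝ)

def Q5 (S : Finset (Fin c → A)) {N : ℕ} (y : Fin N → Fin c → A) : Prop :=
  ∃ m : Fin 6 → Fin N, Function.Injective m ∧ P6 S (y ∘ m)

open Classical in
lemma count_P6 (S : Finset (Fin c → A)) (hS : 1 ≤ S.card) :
    (((Fintype.piFinset fun _ : Fin 6 => S).filter (P6 S)).card : ℝ) ≤
      4 ^ (4 + c * 4) * (S.card : ℝ) ^ 2 * (S.card : ℝ) ^ (2 / 3 : ℝ) := by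
  let φ : (Fin 6 → Fin c → A) → (Fin 4 → Fin c → A) := fun u => ![u 0, u 1, u 2, u 3]
  set T := (Fintype.piFinset fun _ : Fin 6 => S).filter (P6 S) with hT
  set Q := (Fintype.piFinset fun _ : Fin 4 => S).filter
      (fun y => ee (y 0) + ee (y 1) = ee (y 2) + ee (y 3)) with hQ
  have hmaps : ∀ u ∈ T, φ u ∈ Q := by
    intro u hu
    rw [hT, Finset.mem_filter, Fintype.mem_piFinset] at hu
    rw [hQ, Finset.mem_filter, Fintype.mem_piFinset]
    refine ⟨fun i => ?_, ?_⟩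
    · fin_cases i <;> exact hu.1 _
    · exact hu.2.1
  have hcard := Finset.card_eq_sum_card_fiberwise hmaps
  have hq := count_quad S hS
  have hfib : ∀ y ∈ Q, (((T.filter fun u => φ u = y).card : ℕ) : ℝ) ≤ (S.card : ℝ) ^ (2 / 3 : ℝ) := by
    intro y hy
    by_cases hp : ((rr S (ee (y 2) + ee (y 3)) : ℕ) : ℝ) ≤ (S.card : ℝ) ^ (2 / 3 : ℝ)
    · refine le_trans ?_ hp
      norm_cast
      unfold rr
      apply Finset.card_le_card_of_injOn (fun u => (u 4, u 5))
      · intro u hu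
        simp only [Finset.coe_filter, Set.mem_ofPred_eq, hT, Finset.mem_filter, Fintype.mem_piFinset] at hu
        obtain ⟨⟨h1, h2⟩, h3⟩ := hu
        simp only [Finset.coe_filter, Set.mem_ofPred_eq, Finset.mem_product]
        refine ⟨⟨h1 _, h1 _⟩, ?_⟩
        rw [← h3]; exact h2.2.1
      · intro u hu u' hu' h
        simp only [Finset.coe_filter, Set.mem_ofPred_eq] at hu hu'
        have h1 : φ u = φ u' := hu.2.trans hu'.2.symm
        simp only [Prod.mk.injEq] at h
        ext1 i
        fin_cases i
        · exact congrFun h1 0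
        · exact congrFun h1 1
        · exact congrFun h1 2
        · exact congrFun h1 3
        · exact h.1
        · exact h.2
    · have : (T.filter fun u => φ u = y) = ∅ := by
        apply Finset.filter_eq_empty_iff.2
        intro u hu h
        rw [hT, Finset.mem_filter] at hu
        apply hp
        rw [← h]; exact hu.2.2.2
      rw [this]; simp; positivity
  rw [hcard]
  push_cast
  calc _ ≤ ∑ y ∈ Q, (S.card : ℝ) ^ (2 / 3 : ℝ) := Finset.sum_le_sum hfib
    _ = Q.card * (S.card : ℝ) ^ (2 / 3 : ℝ) := by rw [Finset.sum_const, nsmul_eq_mul]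
    _ ≤ _ := by gcongr

open Classical in
lemma count_Q5 (S : Finset (Fin c → A)) (hS : 1 ≤ S.card) (N : ℕ) :
    (((Fintype.piFinset fun _ : Fin N => S).filter (fun y => Q5 S y)).card : ℝ) * (S.card : ℝ) ^ 6 ≤
      (N : ℝ) ^ 6 * (4 ^ (4 + c * 4) * (S.card : ℝ) ^ 2 * (S.card : ℝ) ^ (2 / 3 : ℝ)) * (S.card : ℝ) ^ N := by
  let B : (Fin 6 → Fin N) → Finset (Fin N → Fin c → A) := fun m =>
    if Function.Injective m then
    (Fintype.piFinset fun _ : Fin N => S).filter (fun y => P6 S (y ∘ m)) else ∅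
  have hsub : (Fintype.piFinset fun _ : Fin N => S).filter (fun y => Q5 S y) ⊆ univ.biUnion B := by
    intro y hy
    rw [Finset.mem_filter] at hy
    obtain ⟨hy, m, hm, h⟩ := hy
    simp only [Finset.mem_biUnion, Finset.mem_univ, true_and]
    refine ⟨m, ?_⟩
    simp only [B]
    rw [if_pos hm, Finset.mem_filter]
    exact ⟨hy, h⟩
  have hB : ∀ m, ((B m).card : ℝ) * (S.card : ℝ) ^ 6 ≤
      (4 ^ (4 + c * 4) * (S.card : ℝ) ^ 2 * (S.card : ℝ) ^ (2 / 3 : ℝ)) * (S.card : ℝ) ^ N := by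
    intro m
    simp only [B]
    split_ifs with h
    · refine (count_ext S m h (P6 S)).trans ?_
      gcongr
      exact count_P6 S hS
    · simp; positivity
  calc _ ≤ ((univ.biUnion B).card : ℝ) * (S.card : ℝ) ^ 6 := by
        gcongr
    _ ≤ (∑ m, ((B m).card : ℝ)) * (S.card : ℝ) ^ 6 := by
        gcongr
        exact_mod_cast Finset.card_biUnion_le
    _ = ∑ m, ((B m).card : ℝ) * (S.card : ℝ) ^ 6 := by rw [Finset.sum_mul]
    _ ≤ ∑ m : Fin 6 → Fin N, _ := Finset.sum_le_sum fun mp _ => hB mp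
    _ = _ := by
        rw [Finset.sum_const, nsmul_eq_mul, Finset.card_univ]
        simp only [Fintype.card_fun, Fintype.card_fin]
        push_cast
        ring

end zs
end Ck

namespace Ck
set_option linter.unusedSectionVars false

section gen
variable {c b : ℕ} {A : Type} [Fintype A]

def Abad (S : Finset (Fin c → A)) (p : Om c b A) : Prop :=
  ∃ i : ℕ, ∃ x ∈ S, ∃ y ∈ S, x ≠ y ∧ Hs p i x = Hs p i y ∧
    (S.card : ℝ) ^ (2 / 3 : ℝ) < (rr S (ee x + ee y) : ℕ)

open Classical in
lemma prob_single (v : VV c A × VV c A) (hv : v ≠ 0) :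
    prob (fun p : Om c b A => app2 v p = 0) = ((2 : ℝ) ^ b)⁻¹ := by
  have h := prob_lin (b := b) (fun _ : Unit => v) (LinearIndependent.of_subsingleton () hv)
  simpa using h

lemma inS_ne {i : ℕ} {v : VV c A} (hv : v ≠ 0) : inS i v ≠ 0 := by
  unfold inS
  split_ifs <;> simp [hv]

open Classical in
lemma prob_Abad (S : Finset (Fin c → A)) (hS : 1 ≤ S.card) (hm : (S.card : ℝ) ≤ (2 : ℝ) ^ b) :
    prob (fun p : Om c b A => Abad S p) ≤ 2 * 4 ^ (4 + c * 4) * (S.card : ℝ) ^ (-(1 / 3) : ℝ) := by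
  set n : ℝ := (S.card : ℝ) with hn
  have hn1 : 1 ≤ n := by rw [hn]; exact_mod_cast hS
  have hn0 : 0 < n := by linarith
  let R : VV c A → Finset ((Fin c → A) × (Fin c → A)) := fun d =>
    (S ×ˢ S).filter (fun u => ee u.1 + ee u.2 = d)
  have hR : ∀ d, (R d).card = rr S d := by
    intro d; simp only [R, rr]; congr
  set D : Finset (VV c A) := (S.offDiag.image (fun u => ee u.1 + ee u.2)).filter
    (fun d => n ^ (2 / 3 : ℝ) < (rr S d : ℕ)) with hD
  have hD0 : ∀ d ∈ D, d ≠ 0 := by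
    intro d hd h0
    rw [hD, Finset.mem_filter, Finset.mem_image] at hd
    obtain ⟨⟨u, hu, rfl⟩, _⟩ := hd
    rw [Finset.mem_offDiag] at hu
    rw [vv_eq_iff] at h0
    exact hu.2.2 (ee_inj h0)
  have hcard : (D.card : ℝ) * n ^ (4 / 3 : ℝ) ≤ 4 ^ (4 + c * 4) * n ^ 2 := by
    refine le_trans ?_ (count_quad S hS)
    set Q := (Fintype.piFinset fun _ : Fin 4 => S).filter
      (fun y => ee (y 0) + ee (y 1) = ee (y 2) + ee (y 3)) with hQ
    have h1 : ∑ d ∈ D, (Q.filter fun y => ee (y 0) + ee (y 1) = d).card ≤ Q.card := by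
      rw [← Finset.card_biUnion]
      · apply Finset.card_le_card
        intro y hy
        obtain ⟨d, _, h⟩ := Finset.mem_biUnion.1 hy
        exact (Finset.mem_filter.1 h).1
      · intro d _ d' _ hne
        rw [Function.onFun, Finset.disjoint_left]
        intro y h h'
        exact hne ((Finset.mem_filter.1 h).2.symm.trans (Finset.mem_filter.1 h').2)
    have h2 : ∀ d ∈ D, n ^ (4 / 3 : ℝ) ≤ ((Q.filter fun y => ee (y 0) + ee (y 1) = d).card : ℝ) := by
      intro d hd
      have h3 : (R d ×ˢ R d).card ≤ (Q.filter fun y => ee (y 0) + ee (y 1) = d).card := by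
        apply Finset.card_le_card_of_injOn (fun u => ![u.1.1, u.1.2, u.2.1, u.2.2])
        · intro u hu
          simp only [Finset.coe_product, Set.mem_prod, Finset.mem_coe, R, Finset.mem_filter,
            Finset.mem_product] at hu
          simp only [Finset.mem_coe, Finset.mem_filter, hQ, Fintype.mem_piFinset]
          refine ⟨⟨fun i => ?_, ?_⟩, hu.1.2⟩
          · fin_cases i
            · exact hu.1.1.1
            · exact hu.1.1.2
            · exact hu.2.1.1
            · exact hu.2.1.2
          · exact hu.1.2.trans hu.2.2.symm
        · intro u _ u' _ h
          have h0 := congrFun h 0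
          have h1 := congrFun h 1
          have h2 := congrFun h 2
          have h3 := congrFun h 3
          exact Prod.ext (Prod.ext h0 h1) (Prod.ext h2 h3)
      rw [Finset.card_product, hR] at h3
      have h4 := (Finset.mem_filter.1 hd).2
      calc n ^ (4 / 3 : ℝ) = n ^ (2 / 3 : ℝ) * n ^ (2 / 3 : ℝ) := by
            rw [← Real.rpow_add hn0]; norm_num
        _ ≤ (rr S d : ℝ) * (rr S d : ℝ) := by gcongr
        _ ≤ _ := by exact_mod_cast h3
    calc (D.card : ℝ) * n ^ (4 / 3 : ℝ) = ∑ d ∈ D, n ^ (4 / 3 : ℝ) := by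
          rw [Finset.sum_const, nsmul_eq_mul]
      _ ≤ ∑ d ∈ D, ((Q.filter fun y => ee (y 0) + ee (y 1) = d).card : ℝ) := Finset.sum_le_sum h2
      _ ≤ _ := by exact_mod_cast h1
  have h1 : prob (fun p : Om c b A => Abad S p) ≤
      ∑ id ∈ (range 2 ×ˢ D), prob (fun p : Om c b A => app2 (inS id.1 id.2) p = 0) := by
    refine le_trans (prob_mono ?_) (prob_exists _ _)
    rintro p ⟨i, x, hx, y, hy, hne, hh, hr⟩
    refine ⟨(i % 2, ee x + ee y), ?_, ?_⟩
    · rw [Finset.mem_product, Finset.mem_range, hD, Finset.mem_filter, Finset.mem_image]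
      exact ⟨Nat.mod_lt _ (by norm_num), ⟨(x, y), Finset.mem_offDiag.2 ⟨hx, hy, hne⟩, rfl⟩, hr⟩
    · simp only
      rw [app2_inS, app_add, ← tabHash_eq, ← tabHash_eq]
      change Hs p (i % 2) x + Hs p (i % 2) y = 0
      rw [Hs_congr p (Nat.mod_mod i 2), hh, vadd_self]
  have h2 : ∑ id ∈ (range 2 ×ˢ D), prob (fun p : Om c b A => app2 (inS id.1 id.2) p = 0) =
      2 * D.card * ((2 : ℝ) ^ b)⁻¹ := by
    rw [Finset.sum_congr rfl (g := fun _ => ((2 : ℝ) ^ b)⁻¹)]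
    · rw [Finset.sum_const, Finset.card_product, nsmul_eq_mul]; simp
    · intro id hid
      exact prob_single _ (inS_ne (hD0 _ (Finset.mem_product.1 hid).2))
  rw [h2] at h1
  refine h1.trans ?_
  have h3 : (D.card : ℝ) ≤ 4 ^ (4 + c * 4) * n ^ (2 / 3 : ℝ) := by
    have hp : 0 < n ^ (4 / 3 : ℝ) := by positivity
    refine le_of_mul_le_mul_right (hcard.trans (le_of_eq ?_)) hp
    rw [mul_assoc, ← Real.rpow_add hn0]; norm_num
  have h4 : ((2 : ℝ) ^ b)⁻¹ ≤ n⁻¹ := by gcongr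
  calc 2 * (D.card : ℝ) * ((2 : ℝ) ^ b)⁻¹ ≤ 2 * (4 ^ (4 + c * 4) * n ^ (2 / 3 : ℝ)) * n⁻¹ := by gcongr
    _ = 2 * 4 ^ (4 + c * 4) * (n ^ (2 / 3 : ℝ) * n ^ (-1 : ℝ)) := by rw [Real.rpow_neg_one]; ring
    _ = _ := by rw [← Real.rpow_add hn0]; norm_num

def Gen (S : Finset (Fin c → A)) (lo dh X : ℕ) (Q : ∀ N : ℕ, (Fin N → Fin c → A) → Prop)
    (p : Om c b A) : Prop :=
  ∃ (N σ : ℕ) (x : ℕ → Fin c → A) (V : Fin X → Fin 4 → ℕ) (τ : Fin X → ℕ),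
    N ≤ S.card ∧ (∀ i < N, x i ∈ S) ∧ Q N (fun i => x i) ∧ Det x lo (N - dh) σ X V τ ∧
      Ran p x lo (N - dh) σ X V τ

lemma gen_shift {S : Finset (Fin c → A)} {lo dh X : ℕ} {Q : ∀ N : ℕ, (Fin N → Fin c → A) → Prop}
    {p : Om c b A} (z : ℕ → Fin c → A) (σ s N : ℕ) (hN : N ≤ S.card) (hdh : dh ≤ N)
    (hz : ∀ i, s ≤ i → i < s + N → z i ∈ S) (hQ : Q N (fun i => z (s + i)))
    (V : Fin X → Fin 4 → ℕ) (τ : Fin X → ℕ)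
    (hdet : Det z (s + lo) (s + N - dh) σ X V τ) (hran : Ran p z (s + lo) (s + N - dh) σ X V τ) :
    Gen S lo dh X Q p := by
  classical
  obtain ⟨hI, g, hg⟩ := hdet
  have hV : ∀ r k, s + (V r k - s) = V r k := fun r k => by
    have := ((hg r).1 k).1; omega
  refine ⟨N, σ + s, fun i => z (s + i), fun r k => V r k - s, τ, hN, fun i hi => hz _ (by omega) (by omega),
    hQ, ⟨?_, fun r i => g r (s + i), fun r => ⟨?_, ?_, ?_, ?_⟩⟩, ?_, ?_⟩
  · intro w hw h0
    have := hI (w.map (addLeftEmbedding s)) ?_ ?_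
    · rwa [Finset.map_eq_empty] at this
    · intro i hi
      obtain ⟨j, hj, rfl⟩ := Finset.mem_map.1 hi
      have := Finset.mem_Ico.1 (hw hj)
      simp only [addLeftEmbedding_apply, Finset.mem_Ico]
      omega
    · rw [Finset.sum_map]; exact h0
  · intro k
    have := (hg r).1 k
    simp only; omega
  · simp only [hV]; exact (hg r).2.1
  · intro i h1 h2 h3
    exact (hg r).2.2.1 (s + i) (by omega) (by omega) (by rw [← h3]; congr 1; omega)
  · intro r' hr' hs
    simp only [hV]; exact (hg r).2.2.2 r' hr' hs
  · intro i h1 h2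
    have := hran.1 (s + i) (by omega) (by omega)
    rwa [← add_assoc] at this
  · intro r
    simp only [hV]; exact hran.2 r

open Classical in
lemma prob_gen (S : Finset (Fin c → A)) (hS : 1 ≤ S.card) (lo dh X : ℕ)
    (Q : ∀ N : ℕ, (Fin N → Fin c → A) → Prop) (C1 θ : ℝ) (D : ℕ) (hC1 : 0 ≤ C1)
    (hcount : ∀ N, (((Fintype.piFinset fun _ : Fin N => S).filter (fun y => Q N y)).card : ℝ) ≤
      C1 * ((N : ℝ) + 1) ^ D * (S.card : ℝ) ^ N * θ)
    (hθ : 0 ≤ θ)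
    (q : ℝ) (hq0 : 0 < q) (hq1 : q < 1) (hq : (S.card : ℝ) ≤ q * (2 : ℝ) ^ b)
    (hθ' : θ * (S.card : ℝ) ^ (((lo + dh + 1 : ℕ) : ℝ) - (X : ℝ)) ≤ (S.card : ℝ) ^ (-(1 / 3) : ℝ)) :
    prob (fun p : Om c b A => Gen S lo dh X Q p) ≤
      (2 * 2 ^ X * C1 * q⁻¹ ^ (lo + dh + 1) * ∑' N : ℕ, ((N : ℝ) + 1) ^ (4 * X + D) * q ^ N) *
        (S.card : ℝ) ^ (-(1 / 3) : ℝ) := by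
  set n : ℝ := (S.card : ℝ) with hn
  have hn1 : 1 ≤ n := by rw [hn]; exact_mod_cast hS
  have hn0 : 0 < n := by linarith
  set m : ℝ := (2 : ℝ) ^ b with hm
  have hm0 : 0 < m := by positivity
  obtain ⟨x0, hx0⟩ := Finset.card_pos.1 hS
  let ext : ∀ N : ℕ, (Fin N → Fin c → A) → ℕ → Fin c → A := fun N y i =>
    if h : i < N then y ⟨i, h⟩ else x0
  have hsum : Summable fun N : ℕ => ((N : ℝ) + 1) ^ (4 * X + D) * q ^ N := by
    have h := summable_pow_mul_geometric_of_norm_lt_one (4 * X + D) (r := q)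
      (by rw [Real.norm_of_nonneg hq0.le]; exact hq1)
    have h1 := (summable_nat_add_iff 1).2 h
    have h2 := h1.mul_left q⁻¹
    refine h2.congr fun N => ?_
    push_cast
    rw [pow_succ]; field_simp
  -- union bound
  have hN : ∀ N, prob (fun p : Om c b A => ∃ idx ∈ (range 2 ×ˢ
      ((Fintype.piFinset fun _ : Fin N => S).filter (fun y => Q N y))) ×ˢ
      ((univ : Finset (Fin X → Fin 4 → Fin (N + 1))) ×ˢ (univ : Finset (Fin X → Fin 2))),
      (Det (ext N idx.1.2) lo (N - dh) idx.1.1 X (fun r k => (idx.2.1 r k : ℕ)) (fun r => (idx.2.2 r : ℕ)) ∧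
       Ran p (ext N idx.1.2) lo (N - dh) idx.1.1 X (fun r k => (idx.2.1 r k : ℕ)) (fun r => (idx.2.2 r : ℕ)))) ≤
      (2 * 2 ^ X * C1 * q⁻¹ ^ (lo + dh + 1)) * (((N : ℝ) + 1) ^ (4 * X + D) * q ^ N) * n ^ (-(1 / 3) : ℝ) := by
    intro N
    refine (prob_exists _ _).trans ?_
    refine (Finset.sum_le_sum (g := fun _ => (m⁻¹) ^ ((N - dh - lo - 1) + X)) ?_).trans ?_
    · intro idx _
      by_cases hd : Det (ext N idx.1.2) lo (N - dh) idx.1.1 X (fun r k => (idx.2.1 r k : ℕ)) (fun r => (idx.2.2 r : ℕ))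
      · refine (prob_mono fun p h => h.2).trans (prob_ran hd)
      · rw [prob_false (fun p h => hd h.1)]; positivity
    · rw [Finset.sum_const, nsmul_eq_mul, Finset.card_product, Finset.card_product, Finset.card_product,
        Finset.card_univ, Finset.card_univ]
      simp only [Fintype.card_fun, Fintype.card_fin, Finset.card_range]
      set R := (N - dh - lo - 1) + X with hR
      set cnt := ((Fintype.piFinset fun _ : Fin N => S).filter (fun y => Q N y)).card
      have hpow : n ^ N * m⁻¹ ^ R ≤ q⁻¹ ^ (lo + dh + 1) * q ^ N * n ^ (((lo + dh + 1 : ℕ) : ℝ) - (X : ℝ)) := by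
        have e1 : n ^ N * m⁻¹ ^ R = (n / m) ^ R * n ^ ((N : ℝ) - R) := by
          rw [Real.rpow_sub hn0, Real.rpow_natCast, Real.rpow_natCast, div_pow, inv_pow]
          field_simp
        have e2 : (n / m) ^ R ≤ q ^ R := by
          gcongr
          rw [div_le_iff₀ hm0]; exact hq
        have e3 : q ^ R ≤ q⁻¹ ^ (lo + dh + 1) * q ^ N := by
          rw [inv_pow, ← div_eq_inv_mul, le_div_iff₀ (by positivity), ← pow_add]
          exact pow_le_pow_of_le_one hq0.le hq1.le (by omega)
        have e4 : n ^ ((N : ℝ) - R) ≤ n ^ (((lo + dh + 1 : ℕ) : ℝ) - (X : ℝ)) := by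
          apply Real.rpow_le_rpow_of_exponent_le hn1
          have : N + X ≤ R + (lo + dh + 1) := by omega
          have : ((N + X : ℕ) : ℝ) ≤ ((R + (lo + dh + 1) : ℕ) : ℝ) := by exact_mod_cast this
          push_cast at this ⊢
          linarith
        rw [e1]
        exact mul_le_mul (e2.trans e3) e4 (by positivity) (by positivity)
      have hc := hcount N
      push_cast
      calc 2 * (cnt : ℝ) * ((((N : ℝ) + 1) ^ 4) ^ X * 2 ^ X) * m⁻¹ ^ R
          ≤ 2 * (C1 * ((N : ℝ) + 1) ^ D * n ^ N * θ) * ((((N : ℝ) + 1) ^ 4) ^ X * 2 ^ X) * m⁻¹ ^ R := by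
            gcongr
        _ = (2 * 2 ^ X * C1 * ((N : ℝ) + 1) ^ (4 * X + D)) * (n ^ N * m⁻¹ ^ R) * θ := by
            rw [pow_add _ (4 * X) D, pow_mul]; ring
        _ ≤ (2 * 2 ^ X * C1 * ((N : ℝ) + 1) ^ (4 * X + D)) *
            (q⁻¹ ^ (lo + dh + 1) * q ^ N * n ^ (((lo + dh + 1 : ℕ) : ℝ) - (X : ℝ))) * θ := by
            gcongr
        _ = (2 * 2 ^ X * C1 * ((N : ℝ) + 1) ^ (4 * X + D)) * q⁻¹ ^ (lo + dh + 1) * q ^ N *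
            (θ * n ^ (((lo + dh + 1 : ℕ) : ℝ) - (X : ℝ))) := by ring
        _ ≤ (2 * 2 ^ X * C1 * ((N : ℝ) + 1) ^ (4 * X + D)) * q⁻¹ ^ (lo + dh + 1) * q ^ N *
            (n ^ (-(1 / 3) : ℝ)) := by gcongr
        _ = _ := by ring
  have hG : prob (fun p : Om c b A => Gen S lo dh X Q p) ≤ ∑ N ∈ range (S.card + 1),
      (2 * 2 ^ X * C1 * q⁻¹ ^ (lo + dh + 1)) * (((N : ℝ) + 1) ^ (4 * X + D) * q ^ N) * n ^ (-(1 / 3) : ℝ) := by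
    refine le_trans (prob_mono ?_) ((prob_exists (range (S.card + 1)) _).trans
      (Finset.sum_le_sum fun N _ => hN N))
    rintro p ⟨N, σ, x, V, τ, hNS, hx, hQ, hdet, hran⟩
    refine ⟨N, by simp; omega, ((σ % 2, fun i => x i),
      (fun r k => ⟨V r k, ?_⟩, fun r => ⟨τ r % 2, Nat.mod_lt _ (by norm_num)⟩)), ?_, ?_⟩
    · have := hdet.2
      obtain ⟨g, hg⟩ := this
      have := (hg r).1 k
      omega
    · simp only [Finset.mem_product, Finset.mem_range, Finset.mem_filter, Fintype.mem_piFinset, Finset.mem_univ,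
        and_true]
      exact ⟨Nat.mod_lt _ (by norm_num), fun i => hx _ i.2, hQ⟩
    · have hxe : ∀ i < N, ext N (fun i => x i) i = x i := by
        intro i hi; simp [ext, hi]
      obtain ⟨hI, g, hg⟩ := hdet
      refine ⟨⟨?_, g, fun r => ⟨(hg r).1, (hg r).2.1, ?_, ?_⟩⟩, ?_, ?_⟩
      · intro w hw h0
        apply hI w hw
        rw [← h0]
        apply Finset.sum_congr rfl
        intro i hi
        have := Finset.mem_Ico.1 (hw hi)
        rw [hxe i (by omega)]
      · intro i h1 h2 h3
        simp only [Nat.mod_add_mod, Nat.mod_mod] at h3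
        exact (hg r).2.2.1 i h1 h2 h3
      · intro r' hr h
        simp only [Nat.mod_mod] at h
        exact (hg r).2.2.2 r' hr h
      · intro i h1 h2
        simp only
        rw [hxe i (by omega), hxe (i + 1) (by omega), Hs_congr p (j := σ + i) (by omega)]
        exact hran.1 i h1 h2
      · intro r
        rw [← hran.2 r]
        apply Finset.sum_congr rfl
        intro k _
        have := (hg r).1 k
        simp only
        rw [hxe _ (by omega), Hs_congr p (Nat.mod_mod _ _)]
  refine hG.trans ?_
  rw [← Finset.sum_mul, ← Finset.mul_sum]
  gcongr
  exact hsum.sum_le_tsum _ (fun N _ => by positivity)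

end gen
end Ck

namespace Ck
set_option linter.unusedSectionVars false

section bad
variable {c b : ℕ} {A : Type} [Fintype A]

def Bad (S : Finset (Fin c → A)) (p : Om c b A) : Prop :=
  Abad S p ∨ Gen S 0 0 2 (fun _ _ => True) p ∨ Gen S 0 1 0 (fun _ y => Cov 6 y) p ∨
  Gen S 1 0 1 (fun _ y => Cov 4 y) p ∨ Gen S 1 1 0 (fun _ y => Cov 7 y) p ∨
  Gen S 1 1 0 (fun _ y => Q5 S y) p

noncomputable def GC (lo dh X D : ℕ) (C1 q : ℝ) : ℝ :=
  2 * 2 ^ X * C1 * q⁻¹ ^ (lo + dh + 1) * ∑' N : ℕ, ((N : ℝ) + 1) ^ (4 * X + D) * q ^ N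

lemma GC_nonneg (lo dh X D : ℕ) (C1 q : ℝ) (h : 0 ≤ C1) (hq : 0 < q) : 0 ≤ GC lo dh X D C1 q := by
  unfold GC
  have : 0 ≤ ∑' N : ℕ, ((N : ℝ) + 1) ^ (4 * X + D) * q ^ N := tsum_nonneg fun N => by positivity
  positivity

lemma prob_gen_cov (S : Finset (Fin c → A)) (hS : 1 ≤ S.card) (lo dh X μ : ℕ)
    (q : ℝ) (hq0 : 0 < q) (hq1 : q < 1) (hq : (S.card : ℝ) ≤ q * (2 : ℝ) ^ b)
    (hμ : ((lo + dh + 1 : ℕ) : ℝ) - (X : ℝ) - μ / 2 ≤ -(1 / 3)) :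
    prob (fun p : Om c b A => Gen S lo dh X (fun _ y => Cov μ y) p) ≤
      GC lo dh X (μ + c * μ) 1 q * (S.card : ℝ) ^ (-(1 / 3) : ℝ) := by
  classical
  have hn1 : (1 : ℝ) ≤ S.card := by exact_mod_cast hS
  have hn0 : (0 : ℝ) < S.card := by linarith
  refine prob_gen S hS lo dh X _ 1 ((S.card : ℝ) ^ (-(μ / 2) : ℝ)) (μ + c * μ) zero_le_one ?_ (by positivity)
    q hq0 hq1 hq ?_
  · intro N
    have h := count_cov S μ N
    have hs : (Real.sqrt S.card) ^ μ = (S.card : ℝ) ^ ((μ : ℝ) / 2) := by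
      rw [Real.sqrt_eq_rpow, ← Real.rpow_natCast, ← Real.rpow_mul hn0.le]
      congr 1; ring
    rw [hs] at h
    rw [Real.rpow_neg hn0.le, ← div_eq_mul_inv, le_div_iff₀ (by positivity), one_mul]
    refine h.trans ?_
    gcongr
    linarith
  · rw [← Real.rpow_add hn0]
    exact Real.rpow_le_rpow_of_exponent_le hn1 (by linarith)

lemma prob_bad (c : ℕ) (ε : ℝ) (hε : 0 < ε) : ∃ C : ℝ, 0 < C ∧
    ∀ (A : Type) [Fintype A] (b : ℕ) (S : Finset (Fin c → A)), 1 ≤ S.card →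
      ((2 : ℝ) ^ b) ≥ (1 + ε) * (S.card : ℝ) →
      prob (fun p : Om c b A => Bad S p) ≤ C * (S.card : ℝ) ^ (-(1 / 3) : ℝ) := by
  classical
  set q : ℝ := (1 + ε)⁻¹ with hqdef
  have hq0 : 0 < q := by positivity
  have hq1 : q < 1 := inv_lt_one_of_one_lt₀ (by linarith)
  have hK : (0 : ℝ) ≤ 4 ^ (4 + c * 4) := by positivity
  have g1 := GC_nonneg 0 0 2 0 1 q zero_le_one hq0
  have g2 := GC_nonneg 0 1 0 (6 + c * 6) 1 q zero_le_one hq0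
  have g3 := GC_nonneg 1 0 1 (4 + c * 4) 1 q zero_le_one hq0
  have g4 := GC_nonneg 1 1 0 (7 + c * 7) 1 q zero_le_one hq0
  have g5 := GC_nonneg 1 1 0 6 (4 ^ (4 + c * 4)) q hK hq0
  refine ⟨2 * 4 ^ (4 + c * 4) + (GC 0 0 2 0 1 q + (GC 0 1 0 (6 + c * 6) 1 q + (GC 1 0 1 (4 + c * 4) 1 q +
    (GC 1 1 0 (7 + c * 7) 1 q + GC 1 1 0 6 (4 ^ (4 + c * 4)) q)))), by positivity, ?_⟩
  intro A _ b S hS hm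
  have hn1 : (1 : ℝ) ≤ S.card := by exact_mod_cast hS
  have hn0 : (0 : ℝ) < S.card := by linarith
  have hq : (S.card : ℝ) ≤ q * (2 : ℝ) ^ b := by
    rw [hqdef, inv_mul_eq_div, le_div_iff₀ (by linarith)]; linarith
  have hm1 : (S.card : ℝ) ≤ (2 : ℝ) ^ b := by nlinarith
  have p0 := prob_Abad (b := b) S hS hm1
  have p1 : prob (fun p : Om c b A => Gen S 0 0 2 (fun _ _ => True) p) ≤
      GC 0 0 2 0 1 q * (S.card : ℝ) ^ (-(1 / 3) : ℝ) := by
    refine prob_gen S hS 0 0 2 _ 1 1 0 zero_le_one ?_ zero_le_one q hq0 hq1 hq ?_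
    · intro N
      rw [Finset.filter_true, Fintype.card_piFinset]
      simp
    · rw [one_mul]
      exact Real.rpow_le_rpow_of_exponent_le hn1 (by norm_num)
  have p2 := prob_gen_cov (b := b) S hS 0 1 0 6 q hq0 hq1 hq (by norm_num)
  have p3 := prob_gen_cov (b := b) S hS 1 0 1 4 q hq0 hq1 hq (by norm_num)
  have p4 := prob_gen_cov (b := b) S hS 1 1 0 7 q hq0 hq1 hq (by norm_num)
  have p5 : prob (fun p : Om c b A => Gen S 1 1 0 (fun _ y => Q5 S y) p) ≤
      GC 1 1 0 6 (4 ^ (4 + c * 4)) q * (S.card : ℝ) ^ (-(1 / 3) : ℝ) := by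
    refine prob_gen S hS 1 1 0 _ (4 ^ (4 + c * 4)) ((S.card : ℝ) ^ (-(10 / 3) : ℝ)) 6 hK ?_ (by positivity) q hq0 hq1 hq ?_
    · intro N
      have h := count_Q5 S hS N
      have h6 : (0 : ℝ) < (S.card : ℝ) ^ 6 := by positivity
      refine le_of_mul_le_mul_right (h.trans ?_) h6
      have e : (S.card : ℝ) ^ (-(10 / 3) : ℝ) * (S.card : ℝ) ^ 6 = (S.card : ℝ) ^ 2 * (S.card : ℝ) ^ (2 / 3 : ℝ) := by
        rw [← Real.rpow_natCast, ← Real.rpow_natCast, ← Real.rpow_add hn0, ← Real.rpow_add hn0]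
        norm_num
      calc _ = 4 ^ (4 + c * 4) * (N : ℝ) ^ 6 * (S.card : ℝ) ^ N * ((S.card : ℝ) ^ 2 * (S.card : ℝ) ^ (2 / 3 : ℝ)) := by ring
        _ ≤ 4 ^ (4 + c * 4) * ((N : ℝ) + 1) ^ 6 * (S.card : ℝ) ^ N * ((S.card : ℝ) ^ 2 * (S.card : ℝ) ^ (2 / 3 : ℝ)) := by
          gcongr; linarith
        _ = _ := by rw [← e]; ring
    · rw [← Real.rpow_add hn0]
      exact Real.rpow_le_rpow_of_exponent_le hn1 (by norm_num)
  unfold Bad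
  refine (prob_or _ _).trans ?_
  rw [add_mul]; refine add_le_add p0 ?_
  refine (prob_or _ _).trans ?_
  rw [add_mul]; refine add_le_add p1 ?_
  refine (prob_or _ _).trans ?_
  rw [add_mul]; refine add_le_add p2 ?_
  refine (prob_or _ _).trans ?_
  rw [add_mul]; refine add_le_add p3 ?_
  refine (prob_or _ _).trans ?_
  rw [add_mul]; exact add_le_add p4 p5

end bad
end Ck

namespace Ck
set_option linter.unusedSectionVars false

section core
variable {c b : ℕ} {A : Type} [Fintype A]

def Dep (x : ℕ → Fin c → A) (p q : ℕ) : Prop :=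
  ∃ w : Finset ℕ, w ⊆ Finset.Icc p q ∧ w.Nonempty ∧ ∑ i ∈ w, ee (x i) = 0

lemma Dep.mono {x : ℕ → Fin c → A} {p q p' q' : ℕ} (h : Dep x p q) (hp : p' ≤ p) (hq : q ≤ q') :
    Dep x p' q' := by
  obtain ⟨w, hw, h⟩ := h
  exact ⟨w, hw.trans (Finset.Icc_subset_Icc hp hq), h⟩

lemma ind_of {x : ℕ → Fin c → A} {p q : ℕ} (h : ¬ Dep x p q) : Ind x p (q + 1) := by
  intro w hw h0
  by_contra hne
  refine h ⟨w, ?_, Finset.nonempty_iff_ne_empty.2 hne, h0⟩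
  intro i hi
  have := Finset.mem_Ico.1 (hw hi)
  rw [Finset.mem_Icc]; omega

lemma dep_map {x y : ℕ → Fin c → A} {p q p' q' : ℕ} (φ : ℕ → ℕ) (h : Dep y p q)
    (hy : ∀ i, p ≤ i → i ≤ q → y i = x (φ i))
    (hinj : ∀ i j, p ≤ i → i ≤ q → p ≤ j → j ≤ q → φ i = φ j → i = j)
    (hr : ∀ i, p ≤ i → i ≤ q → p' ≤ φ i ∧ φ i ≤ q') : Dep x p' q' := by
  classical
  obtain ⟨w, hw, hne, h0⟩ := h
  refine ⟨w.image φ, ?_, hne.image _, ?_⟩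
  · intro j hj
    obtain ⟨i, hi, rfl⟩ := Finset.mem_image.1 hj
    have := Finset.mem_Icc.1 (hw hi)
    exact Finset.mem_Icc.2 (hr i this.1 this.2)
  · rw [Finset.sum_image]
    · rw [← h0]
      apply Finset.sum_congr rfl
      intro i hi
      have := Finset.mem_Icc.1 (hw hi)
      rw [hy i this.1 this.2]
    · intro i hi j hj hij
      have h1 := Finset.mem_Icc.1 (hw hi)
      have h2 := Finset.mem_Icc.1 (hw hj)
      exact hinj i j h1.1 h1.2 h2.1 h2.2 hij

structure PTr (S : Finset (Fin c → A)) (p : Om c b A) (x : ℕ → Fin c → A) (σ k : ℕ) : Prop where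
  mem : ∀ i, 1 ≤ i → i ≤ k → x i ∈ S
  inj : ∀ i j, 1 ≤ i → i ≤ k → 1 ≤ j → j ≤ k → x i = x j → i = j
  path : ∀ i, 1 ≤ i → i < k → Hs p (σ + i) (x i) = Hs p (σ + i) (x (i + 1))

def Hv (p : Om c b A) (i : ℕ) (v : VV c A) : Fin b → ZMod 2 := app (if i % 2 = 0 then p.1 else p.2) v

lemma Hs_eq_Hv (p : Om c b A) (i : ℕ) (x : Fin c → A) : Hs p i x = Hv p i (ee x) := tabHash_eq _ _

lemma Hv_add (p : Om c b A) (i : ℕ) (u v : VV c A) : Hv p i (u + v) = Hv p i u + Hv p i v := app_add _ _ _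

lemma Hv_sum {ι : Type*} (p : Om c b A) (i : ℕ) (s : Finset ι) (f : ι → VV c A) :
    Hv p i (∑ j ∈ s, f j) = ∑ j ∈ s, Hv p i (f j) := app_sum _ _ _

lemma Hv_zero (p : Om c b A) (i : ℕ) : Hv p i 0 = 0 := app_zero _

lemma cov_of {x : ℕ → Fin c → A} {s N μ : ℕ} (U : Finset ℕ) (hU : U ⊆ Finset.Ico s (s + N))
    (hcard : μ ≤ U.card) (hcov : ∀ i ∈ U, ∀ l, ∃ j ∈ U, j ≠ i ∧ x j l = x i l) :
    Cov μ (fun i : Fin N => x (s + i)) := by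
  classical
  obtain ⟨U', hU', hc⟩ := Finset.exists_subset_card_eq hcard
  let f := U'.orderEmbOfFin hc
  have hf : ∀ k, f k ∈ U := fun k => hU' (U'.orderEmbOfFin_mem hc k)
  have hf' : ∀ k, s ≤ f k ∧ f k < s + N := fun k => Finset.mem_Ico.1 (hU (hf k))
  refine ⟨fun k => ⟨f k - s, by have := hf' k; omega⟩, ?_, ?_⟩
  · intro k k' h
    simp only [Fin.mk.injEq] at h
    have h1 := hf' k
    have h2 := hf' k'
    apply f.injective
    omega
  · intro k l
    obtain ⟨j, hj, hne, h⟩ := hcov (f k) (hf k) l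
    have h1 := Finset.mem_Ico.1 (hU hj)
    have h2 := hf' k
    refine ⟨⟨j - s, by omega⟩, ?_, ?_⟩
    · intro h3
      simp only [Fin.mk.injEq] at h3
      omega
    · simp only
      rw [show s + (j - s) = j by omega, show s + (f k - s) = f k by omega]
      exact h

/-- covered set -/
def CovSet (x : ℕ → Fin c → A) (U : Finset ℕ) : Prop := ∀ i ∈ U, ∀ l, ∃ j ∈ U, j ≠ i ∧ x j l = x i l

lemma covSet_zs {x : ℕ → Fin c → A} {w : Finset ℕ} (h : ∑ i ∈ w, ee (x i) = 0) : CovSet x w :=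
  fun _ hi l => zs_cover w x h hi l

lemma CovSet.union {x : ℕ → Fin c → A} {U V : Finset ℕ} (hU : CovSet x U) (hV : CovSet x V) :
    CovSet x (U ∪ V) := by
  intro i hi l
  rcases Finset.mem_union.1 hi with h | h
  · obtain ⟨j, hj, h⟩ := hU i h l
    exact ⟨j, Finset.mem_union_left _ hj, h⟩
  · obtain ⟨j, hj, h⟩ := hV i h l
    exact ⟨j, Finset.mem_union_right _ hj, h⟩

variable {S : Finset (Fin c → A)} {p : Om c b A} {x : ℕ → Fin c → A} {σ k : ℕ}

lemma PTr.card_le (h : PTr S p x σ k) : k ≤ S.card := by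
  have := Finset.card_le_card_of_injOn (s := Finset.Icc 1 k) (t := S) x ?_ ?_
  · simpa using this
  · intro i hi
    have := Finset.mem_Icc.1 (Finset.mem_coe.1 hi)
    exact h.mem i this.1 this.2
  · intro i hi j hj hij
    have h1 := Finset.mem_Icc.1 (Finset.mem_coe.1 hi)
    have h2 := Finset.mem_Icc.1 (Finset.mem_coe.1 hj)
    exact h.inj i j h1.1 h1.2 h2.1 h2.2 hij

lemma PTr.four_le (hc : 1 ≤ c) (h : PTr S p x σ k) {w : Finset ℕ} (hw : w ⊆ Finset.Icc 1 k) (hne : w.Nonempty)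
    (h0 : ∑ i ∈ w, ee (x i) = 0) : 4 ≤ w.card := by
  have he := zs_even hc w x h0
  have hpos := Finset.card_pos.2 hne
  by_contra hlt
  have h2 : w.card = 2 := by obtain ⟨r, hr⟩ := he; omega
  obtain ⟨i, j, hij, rfl⟩ := Finset.card_eq_two.1 h2
  rw [Finset.sum_pair hij, vv_eq_iff] at h0
  have h1 := Finset.mem_Icc.1 (hw (Finset.mem_insert_self i {j}))
  have h2 := Finset.mem_Icc.1 (hw (Finset.mem_insert_of_mem (Finset.mem_singleton_self j)))
  exact hij (h.inj i j h1.1 h1.2 h2.1 h2.2 (ee_inj h0))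

lemma PTr.noE2 (h : PTr S p x σ k) (hB : ¬ Bad S p) {P Q : ℕ} (hP : 1 ≤ P) (hPQ : P ≤ Q) (hQ : Q ≤ k)
    (hI : Ind x P Q) (U : Finset ℕ) (hU : U ⊆ Finset.Icc P Q) (hcov : CovSet x U) : U.card < 6 := by
  by_contra hlt
  refine hB (Or.inr (Or.inr (Or.inl ?_)))
  have hk := h.card_le
  have e : P + (Q - P + 1) - 1 = Q := by omega
  refine gen_shift x σ P (Q - P + 1) (by omega) (by omega) (fun i h1 h2 => h.mem i (by omega) (by omega)) ?_
    (fun _ _ => 0) (fun _ => 0) ?_ ?_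
  · refine cov_of U (hU.trans ?_) (by omega) hcov
    intro i hi
    rw [Finset.mem_Icc] at hi
    rw [Finset.mem_Ico]; omega
  · rw [e]
    exact ⟨hI, fun _ _ => 0, fun r => r.elim0⟩
  · rw [e]
    exact ⟨fun i h1 h2 => h.path i (by omega) (by omega), fun r => r.elim0⟩

lemma PTr.noE4 (h : PTr S p x σ k) (hB : ¬ Bad S p) {P Q : ℕ} (hP : 1 ≤ P) (hPQ : P ≤ Q) (hQ : Q ≤ k)
    (hI : Ind x (P + 1) Q) (U : Finset ℕ) (hU : U ⊆ Finset.Icc P Q) (hcov : CovSet x U) : U.card < 7 := by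
  by_contra hlt
  refine hB (Or.inr (Or.inr (Or.inr (Or.inr (Or.inl ?_)))))
  have hk := h.card_le
  have e : P + (Q - P + 1) - 1 = Q := by omega
  refine gen_shift x σ P (Q - P + 1) (by omega) (by omega) (fun i h1 h2 => h.mem i (by omega) (by omega)) ?_
    (fun _ _ => 0) (fun _ => 0) ?_ ?_
  · refine cov_of U (hU.trans ?_) (by omega) hcov
    intro i hi
    rw [Finset.mem_Icc] at hi
    rw [Finset.mem_Ico]; omega
  · rw [e]
    exact ⟨hI, fun _ _ => 0, fun r => r.elim0⟩
  · rw [e]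
    exact ⟨fun i h1 h2 => h.path i (by omega) (by omega), fun r => r.elim0⟩

lemma PTr.noE5 (h : PTr S p x σ k) (hB : ¬ Bad S p) {P Q : ℕ} (hP : 1 ≤ P) (hPQ : P ≤ Q) (hQ : Q ≤ k)
    (hI : Ind x (P + 1) Q) (m : Fin 6 → ℕ) (hm : Function.Injective m) (hr : ∀ i, P ≤ m i ∧ m i ≤ Q)
    (h1 : ee (x (m 0)) + ee (x (m 1)) = ee (x (m 2)) + ee (x (m 3)))
    (h2 : ee (x (m 4)) + ee (x (m 5)) = ee (x (m 2)) + ee (x (m 3)))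
    (h3 : m 3 = m 2 + 1) : False := by
  have hk := h.card_le
  have hunp : ((rr S (ee (x (m 2)) + ee (x (m 3))) : ℕ) : ℝ) ≤ (S.card : ℝ) ^ (2 / 3 : ℝ) := by
    by_contra hgt
    have r2 := hr 2
    have r3 := hr 3
    refine hB (Or.inl ⟨σ + m 2, x (m 2), h.mem _ (by omega) (by omega), x (m 3), h.mem _ (by omega) (by omega), ?_, ?_, ?_⟩)
    · intro he
      have := h.inj _ _ (by omega) (by omega) (by omega) (by omega) he
      omega
    · rw [h3]; exact h.path _ (by omega) (by omega)
    · exact not_le.1 hgt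
  refine hB (Or.inr (Or.inr (Or.inr (Or.inr (Or.inr ?_)))))
  have e : P + (Q - P + 1) - 1 = Q := by omega
  refine gen_shift x σ P (Q - P + 1) (by omega) (by omega) (fun i h1 h2 => h.mem i (by omega) (by omega)) ?_
    (fun _ _ => 0) (fun _ => 0) ?_ ?_
  · have hx : ∀ i, P + (m i - P) = m i := fun i => by have := hr i; omega
    refine ⟨fun i => ⟨m i - P, by have := hr i; omega⟩, ?_, ?_, ?_, ?_⟩
    · intro i j hij
      simp only [Fin.mk.injEq] at hij
      apply hm
      have := hr i; have := hr j; omega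
    · simp only [Function.comp, hx]; exact h1
    · simp only [Function.comp, hx]; exact h2
    · simp only [Function.comp, hx]; exact hunp
  · rw [e]
    exact ⟨hI, fun _ _ => 0, fun r => r.elim0⟩
  · rw [e]
    exact ⟨fun i h1 h2 => h.path i (by omega) (by omega), fun r => r.elim0⟩

lemma PTr.noE3 (hc : 1 ≤ c) (h : PTr S p x σ k) (hB : ¬ Bad S p) {P Q : ℕ} (hP : 1 ≤ P) (hPQ : P ≤ Q) (hQ : Q ≤ k)
    (hI : ¬ Dep x (P + 1) Q) (hD : Dep x P Q) (v0 v1 v2 v3 τ : ℕ) (g : ℕ → ZMod 2)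
    (h0 : P + 1 ≤ v0 ∧ v0 ≤ Q) (h1 : P + 1 ≤ v1 ∧ v1 ≤ Q) (h2 : P + 1 ≤ v2 ∧ v2 ≤ Q) (h3 : P + 1 ≤ v3 ∧ v3 ≤ Q)
    (hs : Hs p τ (x v0) + Hs p τ (x v1) + Hs p τ (x v2) + Hs p τ (x v3) = 0)
    (hg : g v0 + g v1 + g v2 + g v3 = 1)
    (hgp : ∀ i, P + 1 ≤ i → i < Q → (σ + i) % 2 = τ % 2 → g i = g (i + 1)) : False := by
  obtain ⟨U, hU, hne, hz⟩ := hD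
  have h4 := h.four_le hc (hU.trans (Finset.Icc_subset_Icc hP hQ)) hne hz
  refine hB (Or.inr (Or.inr (Or.inr (Or.inl ?_))))
  have hk := h.card_le
  have e : P + (Q - P + 1) - 0 = Q + 1 := by omega
  refine gen_shift x σ P (Q - P + 1) (by omega) (by omega) (fun i h1 h2 => h.mem i (by omega) (by omega)) ?_
    (fun _ => ![v0, v1, v2, v3]) (fun _ => τ) ?_ ?_
  · refine cov_of U (hU.trans ?_) (by omega) (covSet_zs hz)
    intro i hi
    rw [Finset.mem_Icc] at hi
    rw [Finset.mem_Ico]; omega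
  · rw [e]
    refine ⟨ind_of hI, fun _ => g, fun r => ⟨?_, ?_, ?_, ?_⟩⟩
    · intro k
      fin_cases k <;> simp <;> omega
    · rw [Fin.sum_univ_four]; exact hg
    · intro i h1 h2 h3; exact hgp i h1 (by omega) h3
    · intro r' hr'
      have := r.2; have := r'.2
      rw [Fin.lt_def] at hr'; omega
  · rw [e]
    refine ⟨fun i h1 h2 => h.path i (by omega) (by omega), fun r => ?_⟩
    rw [Fin.sum_univ_four]; exact hs

end core
end Ck

namespace Ck
set_option linter.unusedSectionVars false

section core2
variable {c b : ℕ} {A : Type} [Fintype A]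
variable {S : Finset (Fin c → A)} {p : Om c b A} {x : ℕ → Fin c → A} {σ k : ℕ}

structure Mn (x : ℕ → Fin c → A) (k u v : ℕ) : Prop where
  one : 1 ≤ u
  le : v ≤ k
  dep : Dep x u v
  nl : ¬ Dep x (u + 1) v
  nr : ¬ Dep x u (v - 1)

def dl (j i : ℕ) : ZMod 2 := if i = j then 1 else 0

lemma sum_dl (s : Finset ℕ) (j : ℕ) : ∑ i ∈ s, dl j i = if j ∈ s then 1 else 0 := by
  unfold dl
  rw [Finset.sum_ite_eq']

lemma inj6 {a1 a2 a3 a4 a5 a6 : ℕ} (h : [a1, a2, a3, a4, a5, a6].Nodup) :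
    Function.Injective ![a1, a2, a3, a4, a5, a6] := List.nodup_ofFn.1 h

lemma vv4 {a b' d e : VV c A} (h : a + b' + d + e = 0) : a + b' = d + e := by
  rw [← vv_eq_iff, ← add_assoc]; exact h

lemma PTr.min_form (hc : 1 ≤ c) (h : PTr S p x σ k) (hB : ¬ Bad S p) {u v : ℕ} (hM : Mn x k u v) :
    u + 3 ≤ v ∧ v % 2 ≠ u % 2 ∧ ee (x u) + ee (x (u + 1)) + ee (x (v - 1)) + ee (x v) = 0 := by
  classical
  obtain ⟨h1, hk, ⟨w, hw, hne, h0⟩, hnl, hnr⟩ := hM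
  have hu : u ∈ w := by
    by_contra hu
    refine hnl ⟨w, ?_, hne, h0⟩
    intro i hi
    have := Finset.mem_Icc.1 (hw hi)
    have : i ≠ u := fun h => hu (h ▸ hi)
    rw [Finset.mem_Icc]; omega
  have hv : v ∈ w := by
    by_contra hv
    refine hnr ⟨w, ?_, hne, h0⟩
    intro i hi
    have := Finset.mem_Icc.1 (hw hi)
    have : i ≠ v := fun h => hv (h ▸ hi)
    rw [Finset.mem_Icc]; omega
  have huv := Finset.mem_Icc.1 (hw hu)
  have h4 := h.four_le hc (hw.trans (Finset.Icc_subset_Icc h1 hk)) hne h0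
  have hev := zs_even hc w x h0
  have hcl := Finset.card_le_card hw
  rw [Nat.card_Icc] at hcl
  have hI : Ind x u v := by
    have := ind_of hnr
    rwa [show v - 1 + 1 = v by omega] at this
  have h6 := h.noE2 hB h1 huv.2 hk hI w hw (covSet_zs h0)
  have hcard : w.card = 4 := by obtain ⟨r, hr⟩ := hev; omega
  have hec : (w.erase u).card = 3 := by rw [Finset.card_erase_of_mem hu]; omega
  obtain ⟨i1, i2, i3, h12, h13, h23, hE⟩ := Finset.card_eq_three.1 hec
  have hsum : ∀ {M : Type} [AddCommMonoid M] (f : ℕ → M), ∑ i ∈ w.erase u, f i = f i1 + f i2 + f i3 := by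
    intro M _ f
    rw [hE, Finset.sum_insert (by simp [h12, h13]), Finset.sum_pair h23, add_assoc]
  have hmem : ∀ i ∈ w.erase u, u + 1 ≤ i ∧ i ≤ v := by
    intro i hi
    rw [Finset.mem_erase] at hi
    have := Finset.mem_Icc.1 (hw hi.2)
    omega
  have m1 := hmem i1 (by rw [hE]; simp)
  have m2 := hmem i2 (by rw [hE]; simp)
  have m3 := hmem i3 (by rw [hE]; simp)
  have hhash : Hs p (σ + u) (x i1) + Hs p (σ + u) (x i2) + Hs p (σ + u) (x i3) + Hs p (σ + u) (x (u + 1)) = 0 := by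
    rw [← hsum (fun i => Hs p (σ + u) (x i)), ← h.path u h1 (by omega), Finset.sum_erase_add _ _ hu]
    simp only [Hs_eq_Hv]
    rw [← Hv_sum, h0, Hv_zero]
  have key : ∀ g : ℕ → ZMod 2, ∑ i ∈ w.erase u, g i + g (u + 1) = 1 →
      (∀ i, u + 1 ≤ i → i < v → (σ + i) % 2 = (σ + u) % 2 → g i = g (i + 1)) → False := by
    intro g hg hgp
    rw [hsum] at hg
    exact h.noE3 hc hB h1 huv.2 hk hnl ⟨w, hw, hne, h0⟩ i1 i2 i3 (u + 1) (σ + u) g m1 m2 m3 (by omega) hhash hg hgp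
  have c1 : u + 1 ∈ w := by
    by_contra hn
    refine key (dl (u + 1)) ?_ ?_
    · rw [sum_dl, if_neg (by simp [hn])]; simp [dl]
    · intro i h1 h2 h3
      simp only [dl]; rw [if_neg (by omega), if_neg (by omega)]
  have c2 : v % 2 ≠ u % 2 := by
    intro hp
    refine key (dl v) ?_ ?_
    · rw [sum_dl, if_pos (Finset.mem_erase.2 ⟨by omega, hv⟩)]; simp only [dl]; rw [if_neg (by omega)]; simp
    · intro i h1 h2 h3
      simp only [dl]; rw [if_neg (by omega), if_neg (by omega)]
  have c3 : v - 1 ∈ w := by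
    by_contra hn
    have hne1 : v - 1 ≠ u + 1 := fun h => hn (h ▸ c1)
    refine key (fun i => dl (v - 1) i + dl v i) ?_ ?_
    · rw [Finset.sum_add_distrib, sum_dl, sum_dl, if_neg (by simp [hn]),
        if_pos (Finset.mem_erase.2 ⟨by omega, hv⟩)]
      simp only [dl]; rw [if_neg (by omega), if_neg (by omega)]; simp
    · intro i h1 h2 h3
      simp only [dl]
      by_cases hi : i = v - 1
      · rw [if_pos hi, if_neg (by omega), if_neg (by omega), if_pos (by omega)]; simp
      · rw [if_neg hi, if_neg (by omega), if_neg (by omega), if_neg (by omega)]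
  have hw4 : ({u, u + 1, v - 1, v} : Finset ℕ) = w := by
    apply Finset.eq_of_subset_of_card_le
    · intro i hi
      simp only [Finset.mem_insert, Finset.mem_singleton] at hi
      rcases hi with rfl | rfl | rfl | rfl <;> assumption
    · rw [hcard, Finset.card_insert_of_notMem, Finset.card_insert_of_notMem, Finset.card_insert_of_notMem]
      · simp
      · simp; omega
      · simp; omega
      · simp; omega
  refine ⟨by omega, c2, ?_⟩
  rw [← hw4, Finset.sum_insert, Finset.sum_insert, Finset.sum_insert, Finset.sum_singleton] at h0
  · rw [← h0]; abel
  · simp; omega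
  · simp; omega
  · simp; omega

set_option maxHeartbeats 1000000 in
lemma PTr.chain (hc : 1 ≤ c) (h : PTr S p x σ k) (hB : ¬ Bad S p) {u v : ℕ} (hM : Mn x k u v)
    (hD : Dep x (u + 1) k) : Mn x k (u + 1) (v + 1) := by
  classical
  obtain ⟨f1, f2, f3⟩ := h.min_form hc hB hM
  have hu1 := hM.one
  -- q2
  let q2 := Nat.find ⟨k, hD⟩
  have hq2 : Dep x (u + 1) q2 := Nat.find_spec ⟨k, hD⟩
  have hq2k : q2 ≤ k := Nat.find_min' _ hD
  have hq2min : ∀ q < q2, ¬ Dep x (u + 1) q := fun q hq => Nat.find_min ⟨k, hD⟩ hq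
  have hvq : v < q2 := by
    by_contra hle
    exact hM.nl (hq2.mono le_rfl (by omega))
  -- p2
  let p2 := Nat.findGreatest (fun u => Dep x u q2) q2
  have hle : u + 1 ≤ q2 := by omega
  have hp2 : Dep x p2 q2 := Nat.findGreatest_spec (P := fun u => Dep x u q2) hle hq2
  have hp2u : u + 1 ≤ p2 := Nat.le_findGreatest (P := fun u => Dep x u q2) hle hq2
  have hp2max : ¬ Dep x (p2 + 1) q2 := by
    intro hd
    by_cases h' : p2 + 1 ≤ q2
    · have := Nat.le_findGreatest (P := fun u => Dep x u q2) h' hd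
      change p2 + 1 ≤ p2 at this
      omega
    · obtain ⟨w, hw, ⟨i, hi⟩, _⟩ := hd
      have := Finset.mem_Icc.1 (hw hi)
      omega
  have hM2 : Mn x k p2 q2 := ⟨by omega, hq2k, hp2, hp2max,
    fun hd => hq2min (q2 - 1) (by omega) (hd.mono hp2u le_rfl)⟩
  obtain ⟨g1, g2, g3⟩ := h.min_form hc hB hM2
  have hI : Ind x (u + 1) q2 := by
    have := ind_of (hq2min (q2 - 1) (by omega))
    rwa [show q2 - 1 + 1 = q2 by omega] at this
  clear_value p2 q2
  by_contra hcon
  have hng : ¬ (p2 = u + 1 ∧ q2 = v + 1) := by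
    rintro ⟨rfl, rfl⟩
    exact hcon hM2
  have fE := vv4 f3
  have gE := vv4 g3
  by_cases k1 : p2 = u + 1 ∧ v = u + 3
  · obtain ⟨rfl, rfl⟩ := k1
    refine h.noE5 hB hu1 (by omega) hq2k hI ![u, u + 3, u + 1, u + 2, q2 - 1, q2] ?_ ?_ ?_ ?_ ?_
    · apply inj6
      simp only [List.nodup_cons, List.mem_cons, List.not_mem_nil, or_false, not_or, not_false_eq_true, List.nodup_nil, and_true]
      omega
    · simp only [Fin.forall_fin_succ, Fin.isValue, Matrix.cons_val]
      simp
      try omega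
    · show ee (x u) + ee (x (u + 3)) = ee (x (u + 1)) + ee (x (u + 2))
      rw [← vv_eq_iff, ← f3]; simp only [show u + 3 - 1 = u + 2 by omega]; abel
    · show ee (x (q2 - 1)) + ee (x q2) = ee (x (u + 1)) + ee (x (u + 2))
      exact gE.symm
    · rfl
  by_cases k2 : v - 1 = p2
  · have ev : p2 + 1 = v := by omega
    refine h.noE5 hB hu1 (by omega) hq2k hI ![v - 1, v, u, u + 1, q2 - 1, q2] ?_ ?_ ?_ ?_ ?_
    · apply inj6
      simp only [List.nodup_cons, List.mem_cons, List.not_mem_nil, or_false, not_or, not_false_eq_true, List.nodup_nil, and_true]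
      omega
    · simp only [Fin.forall_fin_succ, Fin.isValue, Matrix.cons_val]
      simp
      try omega
    · exact fE.symm
    · show ee (x (q2 - 1)) + ee (x q2) = ee (x u) + ee (x (u + 1))
      rw [fE, k2, ← gE, ev]
    · rfl
  by_cases k3 : v - 1 = p2 + 1 ∧ v = q2 - 1
  · have ev : p2 = v - 2 := by omega
    have eq : q2 = v + 1 := by omega
    subst ev eq
    refine h.noE5 hB hu1 (by omega) hq2k hI ![v - 1, v, u, u + 1, v - 2, v + 1] ?_ ?_ ?_ ?_ ?_
    · apply inj6
      simp only [List.nodup_cons, List.mem_cons, List.not_mem_nil, or_false, not_or, not_false_eq_true, List.nodup_nil, and_true]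
      omega
    · simp only [Fin.forall_fin_succ, Fin.isValue, Matrix.cons_val]
      simp
      try omega
    · exact fE.symm
    · show ee (x (v - 2)) + ee (x (v + 1)) = ee (x u) + ee (x (u + 1))
      rw [fE, ← vv_eq_iff, ← g3]
      simp only [show v - 2 + 1 = v - 1 by omega, show v + 1 - 1 = v by omega]; abel
    · rfl
  -- seven elements
  have hset : ∀ {u v : ℕ}, u + 3 ≤ v → ee (x u) + ee (x (u + 1)) + ee (x (v - 1)) + ee (x v) = 0 →
      CovSet x ({u, u + 1, v - 1, v} : Finset ℕ) ∧ ({u, u + 1, v - 1, v} : Finset ℕ).card = 4 := by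
    intro u v huv hz
    have n1 : u ∉ ({u + 1, v - 1, v} : Finset ℕ) := by simp; omega
    have n2 : u + 1 ∉ ({v - 1, v} : Finset ℕ) := by simp; omega
    have n3 : v - 1 ∉ ({v} : Finset ℕ) := by simp; omega
    constructor
    · apply covSet_zs
      rw [Finset.sum_insert n1, Finset.sum_insert n2, Finset.sum_insert n3, Finset.sum_singleton, ← hz]
      abel
    · rw [Finset.card_insert_of_notMem n1, Finset.card_insert_of_notMem n2, Finset.card_insert_of_notMem n3]
      simp
  obtain ⟨cw, kw⟩ := hset f1 f3
  obtain ⟨cw', kw'⟩ := hset g1 g3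
  have hlt := h.noE4 hB hu1 (by omega : u ≤ q2) hq2k hI _ (by
    intro i hi
    simp only [Finset.mem_union, Finset.mem_insert, Finset.mem_singleton] at hi
    rw [Finset.mem_Icc]; omega) (cw.union cw')
  set W : Finset ℕ := {u, u + 1, v - 1, v} with hW
  have big : ∀ a b' : ℕ, a ∈ ({p2, p2 + 1, q2 - 1, q2} : Finset ℕ) → b' ∈ ({p2, p2 + 1, q2 - 1, q2} : Finset ℕ) →
      a ≠ b' → a ≠ q2 → b' ≠ q2 → a ∉ W → b' ∉ W → False := by
    intro a b' ha hb' hab haq hbq haW hbW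
    have hqW : q2 ∉ W := by rw [hW]; simp; omega
    have hsub : insert a (insert b' (insert q2 W)) ⊆ W ∪ {p2, p2 + 1, q2 - 1, q2} := by
      intro i hi
      rw [Finset.mem_insert, Finset.mem_insert, Finset.mem_insert] at hi
      rw [Finset.mem_union]
      rcases hi with rfl | rfl | rfl | hi
      · exact Or.inr ha
      · exact Or.inr hb'
      · right; simp
      · exact Or.inl hi
    have := Finset.card_le_card hsub
    rw [Finset.card_insert_of_notMem, Finset.card_insert_of_notMem, Finset.card_insert_of_notMem hqW, kw] at this
    · omega
    · rw [Finset.mem_insert]; tauto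
    · rw [Finset.mem_insert, Finset.mem_insert]; tauto
  have mem1 : ∀ i, i ∈ W ↔ (i = u ∨ i = u + 1 ∨ i = v - 1 ∨ i = v) := by
    intro i; rw [hW]; simp
  by_cases A1 : p2 ∈ W
  · by_cases A2 : p2 + 1 ∈ W
    · rw [mem1] at A1 A2; omega
    · by_cases A3 : q2 - 1 ∈ W
      · rw [mem1] at A1 A2 A3; omega
      · exact big (p2 + 1) (q2 - 1) (by simp) (by simp) (by omega) (by omega) (by omega) A2 A3
  · by_cases A2 : p2 + 1 ∈ W
    · by_cases A3 : q2 - 1 ∈ W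
      · rw [mem1] at A1 A2 A3; omega
      · exact big p2 (q2 - 1) (by simp) (by simp) (by omega) (by omega) (by omega) A1 A3
    · exact big p2 (p2 + 1) (by simp) (by simp) (by omega) (by omega) (by omega) A1 A2

end core2
end Ck

namespace Ck
set_option linter.unusedSectionVars false

section core3
variable {c b : ℕ} {A : Type} [Fintype A]
variable {S : Finset (Fin c → A)} {p : Om c b A} {x : ℕ → Fin c → A} {σ k a β : ℕ}

structure Tr (S : Finset (Fin c → A)) (p : Om c b A) (x : ℕ → Fin c → A) (σ k a β : ℕ) : Prop where
  tr : PTr S p x σ k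
  a0 : a % 2 = 0
  a2 : 2 ≤ a
  ak : a + 1 ≤ k
  ha : Hs p σ (x 1) = Hs p σ (x a)
  b0 : β % 2 = k % 2
  b1 : 1 ≤ β
  bk : β + 2 ≤ k
  hb : Hs p (σ + k) (x k) = Hs p (σ + k) (x β)

lemma Tr.hb' (h : Tr S p x σ k a β) : Hs p (σ + k) (x k) = Hs p (σ + k) (x (β + 1)) := by
  have h1 := h.tr.path β h.b1 (by have := h.bk; omega)
  rw [Hs_congr p (show (σ + β) % 2 = (σ + k) % 2 by have := h.b0; omega)] at h1
  rw [h.hb, h1]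

lemma Tr.ha' (h : Tr S p x σ k a β) : Hs p σ (x 1) = Hs p σ (x (a + 1)) := by
  have h1 := h.tr.path a (by have := h.a2; omega) (by have := h.ak; omega)
  rw [Hs_congr p (show (σ + a) % 2 = σ % 2 by have := h.a0; omega)] at h1
  rw [h.ha, h1]

lemma v4 (v : Fin b → ZMod 2) : v + v + v + v = 0 := by
  rw [vadd_self, zero_add, vadd_self]

lemma dep_max {u q : ℕ} (h : Dep x u q) : ∃ r, u ≤ r ∧ r ≤ q ∧ Dep x r q ∧ ¬ Dep x (r + 1) q := by
  classical
  have hle : ∀ {u}, Dep x u q → u ≤ q := by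
    rintro u ⟨w, hw, ⟨i, hi⟩, _⟩
    have := Finset.mem_Icc.1 (hw hi)
    omega
  have h1 := Nat.findGreatest_spec (P := fun u => Dep x u q) (hle h) h
  have h2 := Nat.le_findGreatest (P := fun u => Dep x u q) (hle h) h
  refine ⟨_, h2, hle h1, h1, fun hd => ?_⟩
  have := Nat.le_findGreatest (P := fun u => Dep x u q) (hle hd) hd
  omega

lemma Tr.R (hc : 1 ≤ c) (h : Tr S p x σ k a β) (hB : ¬ Bad S p) {s : ℕ} (h1 : 1 ≤ s)
    (hD : Dep x s k) (hN : ¬ Dep x (s + 1) k) : β + 1 ≤ s := by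
  by_contra hlt
  have := h.bk
  have := h.b0
  refine h.tr.noE3 hc hB h1 (by omega) le_rfl hN hD k (β + 1) k k (σ + k) (dl k) (by omega) (by omega) (by omega) (by omega) ?_ ?_ ?_
  · rw [← h.hb', v4]
  · simp only [dl]; rw [if_pos trivial, if_neg (by omega)]; decide
  · intro i h1 h2 h3
    simp only [dl]; rw [if_neg (by omega), if_neg (by omega)]

lemma Tr.rev (h : Tr S p x σ k a β) : Tr S p (fun i => x (k + 1 - i)) (σ + k) k (k - β) (k - a) := by
  have h1 := h.a0
  have h2 := h.a2
  have h3 := h.ak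
  have h4 := h.b0
  have h5 := h.b1
  have h6 := h.bk
  refine ⟨⟨?_, ?_, ?_⟩, by omega, by omega, by omega, ?_, by omega, by omega, by omega, ?_⟩
  · intro i hi hk; exact h.tr.mem _ (by omega) (by omega)
  · intro i j _ _ _ _ he
    have := h.tr.inj _ _ (by omega) (by omega) (by omega) (by omega) he
    omega
  · intro i hi hk
    have := h.tr.path (k - i) (by omega) (by omega)
    rw [Hs_congr p (show (σ + (k - i)) % 2 = (σ + k + i) % 2 by omega)] at this
    try simp only
    rw [show k + 1 - i = k - i + 1 by omega, show k + 1 - (i + 1) = k - i by omega]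
    exact this.symm
  · try simp only
    rw [show k + 1 - 1 = k by omega, show k + 1 - (k - β) = β + 1 by omega]
    exact h.hb'
  · try simp only
    rw [show k + 1 - k = 1 by omega, show k + 1 - (k - a) = a + 1 by omega,
      Hs_congr p (show (σ + k + k) % 2 = σ % 2 by omega)]
    exact h.ha'

lemma Tr.flip (h : Tr S p x σ k a β) (hab : β < a) :
    Tr S p (fun i => if i ≤ β then x i else x (β + k + 1 - i)) σ k (β + k - a) β := by
  have h1 := h.a0
  have h2 := h.a2
  have h3 := h.ak
  have h4 := h.b0
  have h5 := h.b1
  have h6 := h.bk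
  refine ⟨⟨?_, ?_, ?_⟩, by omega, by omega, by omega, ?_, by omega, by omega, by omega, ?_⟩
  · intro i hi hk
    try simp only
    split_ifs
    · exact h.tr.mem _ (by omega) (by omega)
    · exact h.tr.mem _ (by omega) (by omega)
  · intro i j _ _ _ _ he
    try simp only at he
    split_ifs at he <;> have := h.tr.inj _ _ (by omega) (by omega) (by omega) (by omega) he <;> omega
  · intro i hi hk
    try simp only
    rcases lt_trichotomy i β with hl | rfl | hl
    · rw [if_pos (by omega), if_pos (by omega)]
      exact h.tr.path i hi hk
    · rw [if_pos (by omega), if_neg (by omega), show i + k + 1 - (i + 1) = k by omega,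
        Hs_congr p (show (σ + i) % 2 = (σ + k) % 2 by omega)]
      exact h.hb.symm
    · rw [if_neg (by omega), if_neg (by omega)]
      have := h.tr.path (β + k - i) (by omega) (by omega)
      rw [Hs_congr p (show (σ + (β + k - i)) % 2 = (σ + i) % 2 by omega)] at this
      rw [show β + k + 1 - i = β + k - i + 1 by omega, show β + k + 1 - (i + 1) = β + k - i by omega]
      exact this.symm
  · try simp only
    rw [if_pos (by omega), if_neg (by omega), show β + k + 1 - (β + k - a) = a + 1 by omega]
    exact h.ha'
  · try simp only
    rw [if_pos le_rfl, if_neg (by omega), show β + k + 1 - k = β + 1 by omega, ← h.hb']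
    exact h.hb

lemma Tr.E1 (h : Tr S p x σ k a β) (hB : ¬ Bad S p) : Dep x 1 k := by
  have h1 := h.a0
  have h2 := h.a2
  have h3 := h.ak
  have h4 := h.b0
  have h5 := h.b1
  have h6 := h.bk
  by_contra hn
  refine hB (Or.inr (Or.inl ?_))
  have hk := h.tr.card_le
  have e : 1 + k - 0 = k + 1 := by omega
  have z1 : (1 : ZMod 2) + 0 + 0 + 0 = 1 := by simp
  refine gen_shift x σ 1 k hk (by omega) (fun i h1 h2 => h.tr.mem i (by omega) (by omega)) trivial
    ![![1, a, a, a], ![k, β, β, β]] ![σ, σ + k] ?_ ?_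
  · rw [e]
    refine ⟨ind_of hn, ![dl 1, dl k], ?_⟩
    rw [Fin.forall_fin_two]
    refine ⟨⟨?_, ?_, ?_, ?_⟩, ⟨?_, ?_, ?_, ?_⟩⟩
    · intro i; fin_cases i <;> simp <;> omega
    · rw [Fin.sum_univ_four]
      show dl 1 1 + dl 1 a + dl 1 a + dl 1 a = 1
      simp only [dl]; rw [if_pos trivial, if_neg (by omega), z1]
    · intro i h1 h2 h3
      change (σ + i) % 2 = σ % 2 at h3
      show dl 1 i = dl 1 (i + 1)
      simp only [dl]; rw [if_neg (by omega), if_neg (by omega)]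
    · intro r' hr'
      exact absurd hr' (by simp)
    · intro i; fin_cases i <;> simp <;> omega
    · rw [Fin.sum_univ_four]
      show dl k k + dl k β + dl k β + dl k β = 1
      simp only [dl]; rw [if_pos trivial, if_neg (by omega), z1]
    · intro i h1 h2 h3
      change (σ + i) % 2 = (σ + k) % 2 at h3
      show dl k i = dl k (i + 1)
      simp only [dl]; rw [if_neg (by omega), if_neg (by omega)]
    · intro r' hr' _
      have : r' = 0 := by
        ext; rw [Fin.lt_def] at hr'; simp at hr'; simp [hr']
      subst this
      rw [Fin.sum_univ_four]
      show dl k 1 + dl k a + dl k a + dl k a = 0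
      simp only [dl]; rw [if_neg (by omega), if_neg (by omega)]; simp
  · rw [e]
    refine ⟨fun i h1 h2 => h.tr.path i (by omega) (by omega), ?_⟩
    rw [Fin.forall_fin_two, Fin.sum_univ_four, Fin.sum_univ_four]
    constructor
    · show Hs p σ (x 1) + Hs p σ (x a) + Hs p σ (x a) + Hs p σ (x a) = 0
      rw [h.ha, v4]
    · show Hs p (σ + k) (x k) + Hs p (σ + k) (x β) + Hs p (σ + k) (x β) + Hs p (σ + k) (x β) = 0
      rw [h.hb, v4]

lemma PTr.struct (hc : 1 ≤ c) (h : PTr S p x σ k) (hB : ¬ Bad S p) (hD : Dep x 1 k) :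
    ∃ s l r, 1 ≤ s ∧ s ≤ r ∧ 2 ≤ l ∧ l % 2 = 0 ∧ r + l + 1 ≤ k ∧ Dep x s (s + l + 1) ∧ ¬ Dep x 1 (s + l) ∧
      Dep x r k ∧ ¬ Dep x (r + 1) k ∧
      (∀ q, s ≤ q → q ≤ r + 1 → ee (x q) + ee (x (q + l)) = ee (x s) + ee (x (s + l))) ∧ r + 2 ≤ s + l := by
  classical
  obtain ⟨t, ht, htk, htmin⟩ : ∃ t, Dep x 1 t ∧ t ≤ k ∧ ∀ q < t, ¬ Dep x 1 q :=
    ⟨Nat.find ⟨k, hD⟩, Nat.find_spec ⟨k, hD⟩, Nat.find_min' _ hD, fun q hq => Nat.find_min ⟨k, hD⟩ hq⟩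
  obtain ⟨s, hs1, hst, hs, hsn⟩ := dep_max ht
  obtain ⟨r, hsr, hrk, hr, hrn⟩ := dep_max (hs.mono le_rfl htk)
  have hM : Mn x k s t := ⟨hs1, htk, hs, hsn, fun hd => htmin (t - 1) (by omega) (hd.mono hs1 le_rfl)⟩
  have hf := h.min_form hc hB hM
  have hMj : ∀ j, s + j ≤ r → Mn x k (s + j) (t + j) := by
    intro j
    induction j with
    | zero => intro _; exact hM
    | succ j ih =>
      intro hj
      exact h.chain hc hB (ih (by omega)) (hr.mono (by omega) le_rfl)
  have hMr := (hMj (r - s) (by omega)).le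
  obtain ⟨l, hl⟩ : ∃ l, t = s + l + 1 := ⟨t - s - 1, by omega⟩
  subst hl
  have hstep : ∀ j, s + j ≤ r + 1 → ee (x (s + j)) + ee (x (s + j + l)) = ee (x s) + ee (x (s + l)) := by
    intro j
    induction j with
    | zero => intro _; rfl
    | succ j ih =>
      intro hj
      rw [← ih (by omega)]
      have := (h.min_form hc hB (hMj j (by omega))).2.2
      rw [show s + l + 1 + j - 1 = s + j + l by omega, show s + l + 1 + j = s + (j + 1) + l by omega] at this
      rw [← vv_eq_iff, ← this, ← add_assoc s j 1]; abel
  have hall : ∀ q, s ≤ q → q ≤ r + 1 → ee (x q) + ee (x (q + l)) = ee (x s) + ee (x (s + l)) := by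
    intro q h1 h2
    have := hstep (q - s) (by omega)
    rwa [show s + (q - s) = q by omega] at this
  refine ⟨s, l, r, hs1, hsr, by omega, by omega, by omega, hs, htmin _ (by omega), hr, hrn, hall, ?_⟩
  by_contra hlt
  have h1 := hall (s + l) (by omega) (by omega)
  rw [add_comm (ee (x s))] at h1
  have h2 := h.inj _ _ (by omega) (by omega) (by omega) (by omega) (ee_inj (add_left_cancel h1))
  omega

lemma Tr.main1 (hc : 1 ≤ c) (h : Tr S p x σ k a β) (hB : ¬ Bad S p) :
    ∃ s l r, β + 1 ≤ s ∧ s + l + 1 ≤ a ∧ r + 2 ≤ s + l ∧ Dep x s (s + l + 1) ∧ ¬ Dep x (r + 1) k := by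
  have h1 := h.a0
  have h2 := h.a2
  have h3 := h.ak
  have h4 := h.b0
  have h5 := h.b1
  have h6 := h.bk
  obtain ⟨s, l, r, q1, q2, q3, q4, q5, q6, q7, q8, q9, q10, q11⟩ := h.tr.struct hc hB (h.E1 hB)
  have hr := h.R hc hB (by omega) q8 q9
  refine ⟨s, l, r, ?_, ?_, q11, q6, q9⟩
  · by_contra hlt
    have hh : Hs p (σ + k) (x k) + Hs p (σ + k) (x (β + 1 + l)) + Hs p (σ + k) (x (r + 1)) + Hs p (σ + k) (x (r + 1 + l)) = 0 := by
      rw [h.hb', add_assoc]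
      simp only [Hs_eq_Hv]
      rw [← Hv_add, ← Hv_add, q10 (β + 1) (by omega) (by omega), q10 (r + 1) (by omega) (by omega), vadd_self]
    by_cases he : r + 1 + l = k
    · refine h.tr.noE3 hc hB (by omega) (by omega) le_rfl q9 q8 k (β + 1 + l) (r + 1) (r + 1 + l) (σ + k)
        (fun i => dl (β + l) i + dl (β + 1 + l) i) (by omega) (by omega) (by omega) (by omega) hh ?_ ?_
      · simp only [dl]
        rw [if_neg (by omega), if_neg (by omega), if_neg (by omega), if_pos trivial, if_neg (by omega), if_neg (by omega),
          if_neg (by omega), if_neg (by omega)]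
        decide
      · intro i h1 h2 h3
        simp only [dl]
        by_cases hi : i = β + l
        · rw [if_pos hi, if_neg (by omega), if_neg (by omega), if_pos (by omega)]; simp
        · rw [if_neg hi, if_neg (by omega), if_neg (by omega), if_neg (by omega)]
    · refine h.tr.noE3 hc hB (by omega) (by omega) le_rfl q9 q8 k (β + 1 + l) (r + 1) (r + 1 + l) (σ + k)
        (dl k) (by omega) (by omega) (by omega) (by omega) hh ?_ ?_
      · simp only [dl]
        rw [if_pos trivial, if_neg (by omega), if_neg (by omega), if_neg (by omega)]
        simp
      · intro i h1 h2 h3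
        simp only [dl]; rw [if_neg (by omega), if_neg (by omega)]
  · have hd : Dep (fun i => x (k + 1 - i)) (k + 1 - (s + l + 1)) k := by
      refine dep_map (fun i => k + 1 - i) q6 ?_ ?_ ?_
      · intro i h1 h2
        try simp only
        rw [show k + 1 - (k + 1 - i) = i by omega]
      · intro i j; omega
      · intro i; omega
    have hn : ¬ Dep (fun i => x (k + 1 - i)) (k + 1 - (s + l + 1) + 1) k := by
      intro hd
      refine q7 (dep_map (fun i => k + 1 - i) hd ?_ ?_ ?_)
      · intro i h1 h2; rfl
      · intro i j; omega
      · intro i; omega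
    have := h.rev.R hc hB (by omega) hd hn
    omega

lemma Tr.false (hc : 1 ≤ c) (h : Tr S p x σ k a β) (hB : ¬ Bad S p) : False := by
  have h3 := h.ak
  have h6 := h.bk
  obtain ⟨s, l, r, q1, q2, q3, q4, q5⟩ := h.main1 hc hB
  obtain ⟨s', l', r', z1, z2, z3, z4, z5⟩ := (h.flip (by omega)).main1 hc hB
  apply z5
  refine dep_map (fun i => β + k + 1 - i) q4 ?_ ?_ ?_
  · intro i h1 h2
    try simp only
    rw [if_neg (by omega), show β + k + 1 - (β + k + 1 - i) = i by omega]
  · intro i j; omega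
  · intro i; omega

end core3
end Ck

namespace Ck
set_option linter.unusedSectionVars false

section graph
variable {c b : ℕ} {A : Type} [Fintype A]
variable {S E : Finset (Fin c → A)} {p : Om c b A}

def nd (p : Om c b A) (i : ℕ) (x : Fin c → A) : ℕ × (Fin b → ZMod 2) := (i % 2, Hs p i x)

lemma nd_congr (p : Om c b A) {i j : ℕ} (h : i % 2 = j % 2) (x : Fin c → A) : nd p i x = nd p j x := by
  unfold nd; rw [h, Hs_congr p h]

structure Wk (E : Finset (Fin c → A)) (p : Om c b A) (σ k : ℕ) (e : ℕ → Fin c → A)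
    (v : ℕ → ℕ × (Fin b → ZMod 2)) : Prop where
  mem : ∀ i < k, e i ∈ E
  src : ∀ i < k, v i = nd p (σ + i) (e i)
  tgt : ∀ i < k, v (i + 1) = nd p (σ + i + 1) (e i)

lemma Wk.toTr {σ k a β : ℕ} {e : ℕ → Fin c → A} {v : ℕ → ℕ × (Fin b → ZMod 2)} (h : Wk E p σ k e v)
    (hinj : ∀ i j, i < k → j < k → e i = e j → i = j) (hES : E ⊆ S)
    (ha1 : 1 ≤ a) (hak : a < k) (ha : v 0 = v a) (hb1 : 1 ≤ β) (hbk : β < k) (hb : v k = v β) :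
    Tr S p (fun i => e (i - 1)) σ k a β := by
  have t : ∀ i, 1 ≤ i → i ≤ k → v i = nd p (σ + i) (e (i - 1)) := by
    intro i h1 h2
    have := h.tgt (i - 1) (by omega)
    rwa [show i - 1 + 1 = i by omega, show σ + (i - 1) + 1 = σ + i by omega] at this
  have s0 := h.src 0 (by omega)
  rw [ha, t a ha1 (by omega)] at s0
  have s1 := congrArg Prod.fst s0
  have s2 := congrArg Prod.snd s0
  rw [t k (by omega) le_rfl, t β hb1 (by omega)] at hb
  have b1 := congrArg Prod.fst hb
  have b2 := congrArg Prod.snd hb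
  simp only [nd] at s1 s2 b1 b2
  refine ⟨⟨?_, ?_, ?_⟩, by omega, by omega, by omega, ?_, by omega, hb1, by omega, ?_⟩
  · intro i h1 h2; exact hES (h.mem _ (by omega))
  · intro i j h1 h2 h3 h4 he
    have := hinj _ _ (by omega) (by omega) he
    omega
  · intro i h1 h2
    have := t i h1 (by omega)
    rw [h.src i h2] at this
    have := congrArg Prod.snd this
    simp only [nd] at this
    rw [show i + 1 - 1 = i by omega]
    exact this.symm
  · rw [Hs_congr p (show (σ + a) % 2 = σ % 2 by omega)] at s2
    exact s2.symm
  · rw [Hs_congr p (show (σ + β) % 2 = (σ + k) % 2 by omega)] at b2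
    exact b2

def Part (E : Finset (Fin c → A)) (p : Om c b A) (σ : ℕ) (Vis : Set (ℕ × (Fin b → ZMod 2))) (e0 : Fin c → A)
    (k : ℕ) (e : ℕ → Fin c → A) (v : ℕ → ℕ × (Fin b → ZMod 2)) : Prop :=
  Wk E p σ k e v ∧ e 0 = e0 ∧ (∀ i, 1 ≤ i → i < k → v i ∉ Vis) ∧ (∀ i j, i < k → j < k → v i = v j → i = j) ∧
    ∀ i, i + 1 < k → e (i + 1) ≠ e i

lemma ext_lem (hdeg : ∀ e ∈ E, ∀ j, ∃ e' ∈ E, e' ≠ e ∧ Hs p j e' = Hs p j e)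
    (σ : ℕ) (Vis : Set (ℕ × (Fin b → ZMod 2))) (e0 : Fin c → A) (he0 : e0 ∈ E) :
    ∃ k e v, 1 ≤ k ∧ Part E p σ Vis e0 k e v ∧ (v k ∈ Vis ∨ ∃ j < k, v k = v j) := by
  classical
  by_contra hcon
  push Not at hcon
  have hall : ∀ n, ∃ e v, Part E p σ Vis e0 (n + 1) e v := by
    intro n
    induction n with
    | zero =>
      refine ⟨fun _ => e0, fun i => nd p (σ + i) e0, ⟨?_, ?_, ?_⟩, rfl, ?_, ?_, ?_⟩
      · intro i _; exact he0
      · intro i _; rfl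
      · intro i _; rfl
      · intro i; omega
      · intro i j; omega
      · intro i; omega
    | succ n ih =>
      obtain ⟨e, v, hP⟩ := ih
      obtain ⟨hv1, hv2⟩ := hcon (n + 1) e v (by omega) hP
      obtain ⟨hW, h0, hV, hI, hne⟩ := hP
      obtain ⟨e', he', hee, hH⟩ := hdeg (e n) (hW.mem n (by omega)) (σ + n + 1)
      refine ⟨fun i => if i = n + 1 then e' else e i, fun i => if i = n + 2 then nd p (σ + n + 2) e' else v i,
        ⟨?_, ?_, ?_⟩, ?_, ?_, ?_, ?_⟩
      · intro i hi
        beta_reduce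
        split_ifs with h
        · exact he'
        · exact hW.mem i (by omega)
      · intro i hi
        beta_reduce
        rw [if_neg (by omega)]
        split_ifs with h
        · subst h
          rw [hW.tgt n (by omega)]
          simp only [nd, ← add_assoc, hH]
        · exact hW.src i (by omega)
      · intro i hi
        beta_reduce
        by_cases h : i = n + 1
        · subst h
          rw [if_pos rfl, if_pos rfl]; rfl
        · rw [if_neg (by omega), if_neg h]
          exact hW.tgt i (by omega)
      · beta_reduce
        rw [if_neg (by omega), h0]
      · intro i h1 h2
        beta_reduce
        rw [if_neg (by omega)]
        by_cases h : i = n + 1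
        · subst h; exact hv1
        · exact hV i h1 (by omega)
      · intro i j hi hj hij
        beta_reduce at hij
        rw [if_neg (by omega), if_neg (by omega)] at hij
        by_cases h : i = n + 1
        · by_cases h' : j = n + 1
          · omega
          · subst h
            exact absurd hij (hv2 j (by omega))
        · by_cases h' : j = n + 1
          · subst h'
            exact absurd hij.symm (hv2 i (by omega))
          · exact hI i j (by omega) (by omega) hij
      · intro i hi
        beta_reduce
        rw [if_neg (show i ≠ n + 1 by omega)]
        by_cases h : i = n
        · subst h; rw [if_pos rfl]; exact hee
        · rw [if_neg (by omega)]; exact hne i (by omega)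
  let T : Finset (ℕ × (Fin b → ZMod 2)) := Finset.range 2 ×ˢ Finset.univ
  obtain ⟨e, v, hW, h0, hV, hI, hne⟩ := hall T.card
  have := Finset.card_le_card_of_injOn (s := Finset.range (T.card + 1)) (t := T) v ?_ ?_
  · rw [Finset.card_range] at this; omega
  · intro i hi
    have := Finset.mem_range.1 (Finset.mem_coe.1 hi)
    rw [hW.src i this]
    simp only [T, nd, Finset.coe_product, Set.mem_prod, Finset.mem_coe, Finset.mem_range, Finset.mem_univ, and_true]
    omega
  · intro i hi j hj hij
    exact hI i j (Finset.mem_range.1 (Finset.mem_coe.1 hi)) (Finset.mem_range.1 (Finset.mem_coe.1 hj)) hij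

lemma Part.inj {σ k : ℕ} {Vis : Set (ℕ × (Fin b → ZMod 2))} {e0 : Fin c → A} {e : ℕ → Fin c → A}
    {v : ℕ → ℕ × (Fin b → ZMod 2)} (h : Part E p σ Vis e0 k e v) :
    ∀ i j, i < k → j < k → e i = e j → i = j := by
  obtain ⟨hW, h0, hV, hI, hne⟩ := h
  have key : ∀ i j, i < j → j < k → e i ≠ e j := by
    intro i j hij hj he
    have hs := hW.src j hj
    rw [← he] at hs
    by_cases hp : i % 2 = j % 2
    · rw [nd_congr p (show (σ + j) % 2 = (σ + i) % 2 by omega), ← hW.src i (by omega)] at hs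
      have := hI _ _ (by omega) (by omega) hs
      omega
    · rw [nd_congr p (show (σ + j) % 2 = (σ + i + 1) % 2 by omega), ← hW.tgt i (by omega)] at hs
      have := hI _ _ (by omega) (by omega) hs
      subst this
      exact hne i (by omega) he.symm
  intro i j hi hj he
  rcases lt_trichotomy i j with hl | hl | hl
  · exact absurd he (key i j hl hj)
  · exact hl
  · exact absurd he.symm (key j i hl hi)

lemma graph_tr (hES : E ⊆ S) (hdeg : ∀ e ∈ E, ∀ j, ∃ e' ∈ E, e' ≠ e ∧ Hs p j e' = Hs p j e)
    (h3 : ∃ σ, ∃ e1 ∈ E, ∃ e2 ∈ E, ∃ e3 ∈ E, e1 ≠ e2 ∧ e1 ≠ e3 ∧ e2 ≠ e3 ∧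
      Hs p σ e2 = Hs p σ e1 ∧ Hs p σ e3 = Hs p σ e1) :
    ∃ x σ k a β, Tr S p x σ k a β := by
  classical
  obtain ⟨σ, e1, m1, e2, m2, e3, m3, n12, n13, n23, H2, H3⟩ := h3
  obtain ⟨k1, e, v, hk1, hP, hend⟩ := ext_lem hdeg σ {nd p σ e1} e1 m1
  have hinj := hP.inj
  obtain ⟨hW, h0, hV, hI, hne⟩ := hP
  have hv0 : v 0 = nd p σ e1 := by have := hW.src 0 (by omega); rwa [h0] at this
  have hend' : ∃ j < k1, v k1 = v j := by
    rcases hend with h | h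
    · exact ⟨0, by omega, by rw [hv0]; exact h⟩
    · exact h
  obtain ⟨f, hf, hfu, hf1, hfk⟩ : ∃ f ∈ E, nd p σ f = v 0 ∧ f ≠ e 0 ∧ f ≠ e (k1 - 1) := by
    by_cases hh : e2 = e (k1 - 1)
    · exact ⟨e3, m3, by rw [hv0]; simp only [nd, H3], by rw [h0]; exact n13.symm, by rw [← hh]; exact n23.symm⟩
    · exact ⟨e2, m2, by rw [hv0]; simp only [nd, H2], by rw [h0]; exact n12.symm, hh⟩
  obtain ⟨k2, e', v', hk2, hP', hend2⟩ := ext_lem hdeg σ {w | ∃ j < k1, w = v j} f hf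
  have hinj' := hP'.inj
  obtain ⟨hW', h0', hV', hI', hne'⟩ := hP'
  have hv0' : v' 0 = v 0 := by have := hW'.src 0 (by omega); rw [this, ← hfu, h0']; rfl
  have hvis : ∀ j ≤ k1, ∃ j' < k1, v j = v j' := by
    intro j hj
    by_cases h : j = k1
    · rw [h]; exact hend'
    · exact ⟨j, by omega, rfl⟩
  have hdis : ∀ i j, i < k2 → j < k1 → e' i ≠ e j := by
    intro i j hi hj he
    by_cases hi0 : i = 0
    · subst hi0
      rw [h0'] at he
      by_cases hp : j % 2 = 0
      · have hs := hW.src j hj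
        rw [← he, nd_congr p (show (σ + j) % 2 = σ % 2 by omega), hfu] at hs
        have := hI _ _ hj (by omega) hs
        subst this
        exact hf1 he
      · have hs := hW.tgt j hj
        rw [← he, nd_congr p (show (σ + j + 1) % 2 = σ % 2 by omega), hfu] at hs
        by_cases hl : j + 1 < k1
        · have := hI _ _ hl (by omega) hs
          omega
        · rw [show j = k1 - 1 by omega] at he
          exact hfk he
    · refine hV' i (by omega) hi ?_
      have hs := hW'.src i hi
      rw [he] at hs
      by_cases hp : i % 2 = j % 2
      · rw [nd_congr p (show (σ + i) % 2 = (σ + j) % 2 by omega), ← hW.src j hj] at hs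
        exact ⟨j, hj, hs⟩
      · rw [nd_congr p (show (σ + i) % 2 = (σ + j + 1) % 2 by omega), ← hW.tgt j hj] at hs
        rw [hs]; exact hvis _ (by omega)
  let z : ℕ → Fin c → A := fun i => if i < k2 then e' (k2 - 1 - i) else e (i - k2)
  let Z : ℕ → ℕ × (Fin b → ZMod 2) := fun i => if i ≤ k2 then v' (k2 - i) else v (i - k2)
  have Z2 : ∀ i, Z (k2 + i) = v i := by
    intro i
    simp only [Z]
    by_cases h : i = 0
    · subst h; rw [if_pos (by omega)]; simp [hv0']
    · rw [if_neg (by omega)]; congr 1; omega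
  have Z1 : ∀ i ≤ k2, Z (k2 - i) = v' i := by
    intro i hi
    simp only [Z]
    rw [if_pos (by omega)]; congr 1; omega
  have hWz : Wk E p (σ + k2) (k2 + k1) z Z := by
    refine ⟨?_, ?_, ?_⟩
    · intro i hi
      simp only [z]
      split_ifs
      · exact hW'.mem _ (by omega)
      · exact hW.mem _ (by omega)
    · intro i hi
      simp only [z]
      split_ifs with h
      · have t := hW'.tgt (k2 - 1 - i) (by omega)
        rw [nd_congr p (show (σ + (k2 - 1 - i) + 1) % 2 = (σ + k2 + i) % 2 by omega), ← Z1 _ (by omega)] at t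
        rwa [show k2 - (k2 - 1 - i + 1) = i by omega] at t
      · have t := hW.src (i - k2) (by omega)
        rw [nd_congr p (show (σ + (i - k2)) % 2 = (σ + k2 + i) % 2 by omega), ← Z2] at t
        rwa [show k2 + (i - k2) = i by omega] at t
    · intro i hi
      simp only [z]
      split_ifs with h
      · have t := hW'.src (k2 - 1 - i) (by omega)
        rw [nd_congr p (show (σ + (k2 - 1 - i)) % 2 = (σ + k2 + i + 1) % 2 by omega), ← Z1 _ (by omega)] at t
        rwa [show k2 - (k2 - 1 - i) = i + 1 by omega] at t
      · have t := hW.tgt (i - k2) (by omega)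
        rw [nd_congr p (show (σ + (i - k2) + 1) % 2 = (σ + k2 + i + 1) % 2 by omega), ← Z2] at t
        rwa [show k2 + (i - k2 + 1) = i + 1 by omega] at t
  have hzinj : ∀ i j, i < k2 + k1 → j < k2 + k1 → z i = z j → i = j := by
    intro i j hi hj he
    simp only [z] at he
    split_ifs at he with g1 g2 g2
    · have := hinj' _ _ (by omega) (by omega) he; omega
    · exact absurd he (hdis _ _ (by omega) (by omega))
    · exact absurd he.symm (hdis _ _ (by omega) (by omega))
    · have := hinj _ _ (by omega) (by omega) he; omega
  obtain ⟨j, hj, hvj⟩ := hend'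
  have hZ0 : Z 0 = v' k2 := by have := Z1 k2 le_rfl; rwa [Nat.sub_self] at this
  obtain ⟨a, ha1, hak, ha⟩ : ∃ a, 1 ≤ a ∧ a < k2 + k1 ∧ Z 0 = Z a := by
    rcases hend2 with ⟨i, hi, h⟩ | ⟨i, hi, h⟩
    · exact ⟨k2 + i, by omega, by omega, by rw [hZ0, h, Z2]⟩
    · exact ⟨k2 - i, by omega, by omega, by rw [hZ0, h, Z1 i (by omega)]⟩
  exact ⟨_, _, _, a, k2 + j, hWz.toTr hzinj hES ha1 hak ha (by omega) (by omega) (by rw [Z2, Z2, hvj])⟩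

lemma hall_part (hfail : ¬ CuckooSucceeds S (tabHash p.1) (tabHash p.2)) :
    ∃ E ⊆ S, (∀ e ∈ E, ∀ j, ∃ e' ∈ E, e' ≠ e ∧ Hs p j e' = Hs p j e) ∧
      ∃ σ, ∃ e1 ∈ E, ∃ e2 ∈ E, ∃ e3 ∈ E, e1 ≠ e2 ∧ e1 ≠ e3 ∧ e2 ≠ e3 ∧
      Hs p σ e2 = Hs p σ e1 ∧ Hs p σ e3 = Hs p σ e1 := by
  classical
  have hex : ∃ n, ∃ E ⊆ S, E.card = n ∧ (E.image (Hs p 0)).card + (E.image (Hs p 1)).card < E.card := by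
    by_contra hcon
    push Not at hcon
    apply hfail
    let t : {x // x ∈ S} → Finset (Fin 2 × (Fin b → ZMod 2)) := fun x => {(0, Hs p 0 x.1), (1, Hs p 1 x.1)}
    have hall : ∀ s : Finset {x // x ∈ S}, s.card ≤ (s.biUnion t).card := by
      intro s
      have h1 := hcon _ (s.map (Function.Embedding.subtype _)) (by
        intro y hy
        obtain ⟨w, _, rfl⟩ := Finset.mem_map.1 hy
        exact w.2) rfl
      rw [Finset.card_map] at h1
      refine h1.trans ?_
      have i0 : Function.Injective (fun w : Fin b → ZMod 2 => ((0 : Fin 2), w)) := fun a b h => (Prod.ext_iff.1 h).2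
      have i1 : Function.Injective (fun w : Fin b → ZMod 2 => ((1 : Fin 2), w)) := fun a b h => (Prod.ext_iff.1 h).2
      rw [← Finset.card_image_of_injective _ i0, ← Finset.card_image_of_injective (Finset.image (Hs p 1) _) i1,
        ← Finset.card_union_of_disjoint]
      · apply Finset.card_le_card
        intro w hw
        rw [Finset.mem_biUnion]
        rcases Finset.mem_union.1 hw with h | h
        all_goals
          obtain ⟨w1, g1, rfl⟩ := Finset.mem_image.1 h
          obtain ⟨w2, g2, rfl⟩ := Finset.mem_image.1 g1
          obtain ⟨w3, g3, rfl⟩ := Finset.mem_map.1 g2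
          exact ⟨w3, g3, by simp [t]⟩
      · rw [Finset.disjoint_left]
        intro w h1 h2
        obtain ⟨w', _, rfl⟩ := Finset.mem_image.1 h1
        obtain ⟨w', _, h⟩ := Finset.mem_image.1 h2
        have := (Prod.ext_iff.1 h).1
        simp at this
    obtain ⟨f, hf, hft⟩ := (Finset.all_card_le_biUnion_card_iff_exists_injective t).1 hall
    refine ⟨fun x => if h : x ∈ S then f ⟨x, h⟩ else 0, ?_, ?_⟩
    · intro x hx y hy hxy
      have hx := Finset.mem_coe.1 hx
      have hy := Finset.mem_coe.1 hy
      beta_reduce at hxy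
      rw [dif_pos hx, dif_pos hy] at hxy
      exact congrArg Subtype.val (hf hxy)
    · intro x hx
      beta_reduce
      rw [dif_pos hx]
      have := hft ⟨x, hx⟩
      simpa [t, Hs] using this
  obtain ⟨E, hES, hEn, hlt⟩ := Nat.find_spec hex
  have hmin := fun m hm => Nat.find_min hex (m := m) hm
  rw [← hEn] at hmin
  have hle : ∀ E' ⊆ E, E' ≠ E → E'.card ≤ (E'.image (Hs p 0)).card + (E'.image (Hs p 1)).card := by
    intro E' h1 h2
    by_contra hlt
    exact hmin _ (Finset.card_lt_card (Finset.ssubset_iff_subset_ne.2 ⟨h1, h2⟩)) ⟨E', h1.trans hES, rfl, by omega⟩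
  refine ⟨E, hES, ?_, ?_⟩
  · have key : ∀ e ∈ E, ∀ j, j < 2 → ∃ e' ∈ E, e' ≠ e ∧ Hs p j e' = Hs p j e := by
      intro e he j hj
      by_contra hcon
      push Not at hcon
      have h1 := hle (E.erase e) (Finset.erase_subset _ _) (by
        intro h; rw [← h] at he; exact Finset.notMem_erase _ _ he)
      rw [Finset.card_erase_of_mem he] at h1
      have hs : ∀ i, ((E.erase e).image (Hs p i)).card ≤ (E.image (Hs p i)).card := fun i =>
        Finset.card_le_card (Finset.image_subset_image (Finset.erase_subset _ _))
      have hj' : ((E.erase e).image (Hs p j)).card + 1 ≤ (E.image (Hs p j)).card := by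
        apply Finset.card_lt_card
        rw [Finset.ssubset_iff_of_subset (Finset.image_subset_image (Finset.erase_subset _ _))]
        refine ⟨Hs p j e, Finset.mem_image_of_mem _ he, ?_⟩
        intro h
        obtain ⟨e', h, hh⟩ := Finset.mem_image.1 h
        rw [Finset.mem_erase] at h
        exact hcon e' h.2 h.1 hh
      have := hs 0
      have := hs 1
      have : j = 0 ∨ j = 1 := by omega
      rcases this with rfl | rfl <;> omega
    intro e he j
    have := key e he (j % 2) (by omega)
    rwa [Hs_congr p (show j % 2 % 2 = j % 2 by omega)] at this
  · by_contra hcon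
    have h2 : ∀ σ, E.card ≤ 2 * (E.image (Hs p σ)).card := by
      intro σ
      apply Finset.card_le_mul_card_image
      intro w _
      by_contra hlt
      obtain ⟨e1, m1, e2, m2, e3, m3, n12, n13, n23⟩ := Finset.two_lt_card.1 (not_le.1 hlt)
      rw [Finset.mem_filter] at m1 m2 m3
      exact hcon ⟨σ, e1, m1.1, e2, m2.1, e3, m3.1, n12, n13, n23, m2.2.trans m1.2.symm, m3.2.trans m1.2.symm⟩
    have := h2 0
    have := h2 1
    omega

lemma fail_bad (hc : 1 ≤ c) (hfail : ¬ CuckooSucceeds S (tabHash p.1) (tabHash p.2)) : Bad S p := by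
  by_contra hB
  obtain ⟨E, hES, hdeg, h3⟩ := hall_part hfail
  obtain ⟨x, σ, k, a, β, h⟩ := graph_tr hES hdeg h3
  exact h.false hc hB

end graph
end Ck
/-- Cuckoo hashing with two independent simple tabulation hash functions fails
with probability `O(n^{-1/3})`. -/
theorem simple_tabulation_cuckoo_upper :
    ∀ c : ℕ, 1 ≤ c → ∀ ε : ℝ, 0 < ε →
    ∃ C : ℝ, 0 < C ∧
      ∀ (A : Type) [Fintype A] (b : ℕ) (S : Finset (Fin c → A)),
        1 ≤ S.card →
        ((2 : ℝ) ^ b) ≥ (1 + ε) * (S.card : ℝ) →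
        tabPr2 c b A (fun T₀ T₁ =>
            ¬ CuckooSucceeds S (tabHash T₀) (tabHash T₁)) ≤
          C * (S.card : ℝ) ^ (-(1 / 3) : ℝ) := by
  intro c hc ε hε
  obtain ⟨C, hC, h⟩ := Ck.prob_bad c ε hε
  refine ⟨C, hC, ?_⟩
  intro A _ b S hS hm
  refine le_trans ?_ (h A b S hS hm)
  exact Ck.prob_mono (P := fun p : Ck.Om c b A => ¬ CuckooSucceeds S (tabHash p.1) (tabHash p.2))
    (fun p hp => Ck.fail_bad hc hp)
end

section
/- There exists a constant c₀ > 0 such that for every k ≥ 1 the following holds. Let Σ be an alphabet of size r = 2^k, take c = 3 characters, let S = Σ³ be the set of all n = r³ keys, and hash into m = 2·r³ = 2^{3k+1} bins. If h₀ and h₁ are two independent random simple tabulation hash functions into m bins, then the probability that there is no injective map f : S → Fin 2 × (ZMod 2)^b with f(x) ∈ {(0, h₀(x)), (1, h₁(x))} for every x ∈ S (i.e., that cuckoo hashing fails) is at least c₀·n^{−1/3}. -/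
open Finset

theorem tl_card_pre {G H : Type} [AddGroup G] [AddGroup H] [Fintype G] [Fintype H]
    [DecidableEq H] (φ : G →+ H) (hφ : Function.Surjective φ) (P : H → Prop) [DecidablePred P] :
    (#{g : G | P (φ g)} : ℝ) * Fintype.card H = (#{h : H | P h} : ℝ) * Fintype.card G := by
  have key : ∀ h : H, #{g : G | φ g = h} = #{g : G | φ g = 0} := fun h =>
    AddMonoidHom.card_fiber_eq_of_mem_range φ (hφ h) (hφ 0)
  have h1 : #{g : G | P (φ g)} = #{h : H | P h} * #{g : G | φ g = 0} := by
    rw [Finset.card_eq_sum_card_fiberwise (f := φ) (t := ({h : H | P h} : Finset H))]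
    · rw [Finset.sum_const_nat]
      intro h hh
      rw [← key h]
      congr 1
      ext g
      simp only [Finset.mem_filter, Finset.mem_univ, true_and] at *
      constructor
      · exact fun h => h.2
      · rintro rfl
        exact ⟨hh, rfl⟩
    · intro g hg
      simpa using hg
  have h2 : Fintype.card G = Fintype.card H * #{g : G | φ g = 0} := by
    rw [← Finset.card_univ (α := G),
      Finset.card_eq_sum_card_fiberwise (f := φ) (t := (Finset.univ : Finset H))]
    · rw [Finset.sum_const_nat (m := #{g : G | φ g = 0})]
      · simp
      · intro h _
        exact key h
    · intro g hg
      simp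
  rw [h1, h2]
  push_cast
  ring

theorem tl_second_moment {Ω : Type} [Fintype Ω] (N : Ω → ℝ) :
    (∑ ω, N ω) ^ 2 ≤ (#{ω : Ω | N ω ≠ 0} : ℝ) * ∑ ω, N ω ^ 2 := by
  have h1 : ∑ ω, N ω = ∑ ω ∈ ({ω : Ω | N ω ≠ 0} : Finset Ω), N ω := by
    rw [Finset.sum_filter_ne_zero]
  rw [h1]
  refine (sq_sum_le_card_mul_sum_sq).trans ?_
  gcongr
  simp

section
variable {Q V : Type} [Fintype Q] [DecidableEq Q] [Fintype V] [DecidableEq V] [AddCommGroup V]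

def tlHom (w : Q × Q) : (Q → V) × (Q → V) →+ V where
  toFun x := x.1 w.1 + x.2 w.2
  map_zero' := by simp
  map_add' x y := by simp; abel

theorem tlHom_surj (w : Q × Q) : Function.Surjective (tlHom (V := V) w) := by
  intro v
  refine ⟨(fun _ => v, 0), ?_⟩
  simp [tlHom]

theorem tlHom2_surj (w w' : Q × Q) (h : w ≠ w') :
    Function.Surjective ((tlHom (V := V) w).prod (tlHom w')) := by
  rintro ⟨v, v'⟩
  by_cases h1 : w.1 = w'.1
  · have h2 : w.2 ≠ w'.2 := fun h2 => h (Prod.ext h1 h2)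
    refine ⟨(0, fun z => if z = w.2 then v else v'), ?_⟩
    simp [tlHom, h2.symm]
  · refine ⟨(fun z => if z = w.1 then v else v', 0), ?_⟩
    simp [tlHom, Ne.symm h1]

def tlN (x : (Q → V) × (Q → V)) (v : V) : ℝ := ∑ w : Q × Q, if tlHom w x = v then 1 else 0

theorem tlN_sum (v : V) : (∑ x : (Q → V) × (Q → V), tlN x v) * Fintype.card V =
    (Fintype.card Q : ℝ) ^ 2 * Fintype.card ((Q → V) × (Q → V)) := by
  unfold tlN
  rw [Finset.sum_comm, Finset.sum_mul]
  have : ∀ w : Q × Q, (∑ x : (Q → V) × (Q → V), if tlHom w x = v then (1:ℝ) else 0) *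
      Fintype.card V = Fintype.card ((Q → V) × (Q → V)) := by
    intro w
    rw [Finset.sum_boole, tl_card_pre (tlHom w) (tlHom_surj w) (fun u => u = v)]
    simp [Finset.filter_eq']
  rw [Finset.sum_congr rfl (fun w _ => this w)]
  simp [Fintype.card_prod]
  ring

theorem tlN_sum2 (v v' : V) : (∑ x : (Q → V) × (Q → V), tlN x v * tlN x v') ≤
    (Fintype.card Q : ℝ) ^ 4 * Fintype.card ((Q → V) × (Q → V)) / (Fintype.card V) ^ 2 +
    (if v = v' then (Fintype.card Q : ℝ) ^ 2 * Fintype.card ((Q → V) × (Q → V)) /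
      Fintype.card V else 0) := by
  have hV : (0 : ℝ) < Fintype.card V := by exact_mod_cast Fintype.card_pos
  set L : ℝ := ((Fintype.card ((Q → V) × (Q → V)) : ℕ) : ℝ) with hL
  have key : ∀ w w' : Q × Q, (∑ x : (Q → V) × (Q → V),
      (if tlHom w x = v then (1:ℝ) else 0) * (if tlHom w' x = v' then (1:ℝ) else 0)) ≤
      L / (Fintype.card V) ^ 2 + if w = w' then (if v = v' then L / Fintype.card V else 0) else 0 := by
    intro w w'
    have e1 : ∀ x : (Q → V) × (Q → V),
      (if tlHom w x = v then (1:ℝ) else 0) * (if tlHom w' x = v' then (1:ℝ) else 0) =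
      if (tlHom w x = v ∧ tlHom w' x = v') then 1 else 0 := by
      intro x
      by_cases h1 : tlHom w x = v <;> by_cases h2 : tlHom w' x = v' <;> simp [h1, h2]
    rw [Finset.sum_congr rfl (fun x _ => e1 x), Finset.sum_boole]
    by_cases h : w = w'
    · subst h
      by_cases hv : v = v'
      · subst hv
        have := tl_card_pre (tlHom w) (tlHom_surj w) (fun u => u = v)
        simp only [if_true, and_self]
        have h3 : (#{x : (Q → V) × (Q → V) | tlHom w x = v} : ℝ) = L / Fintype.card V := by
          rw [eq_div_iff hV.ne', this]
          simp [hL, Finset.filter_eq']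
        rw [h3]
        have : 0 ≤ L / (Fintype.card V : ℝ) ^ 2 := by positivity
        linarith
      · have : (Finset.univ.filter fun x : (Q → V) × (Q → V) => tlHom w x = v ∧ tlHom w x = v') = ∅ := by
          ext x
          simp
          rintro rfl
          exact hv
        rw [this]
        simp only [hv, if_true, if_false, Finset.card_empty, Nat.cast_zero]
        positivity
    · have := tl_card_pre (H := V × V) ((tlHom w).prod (tlHom w')) (tlHom2_surj (V := V) w w' h)
        (fun u : V × V => u.1 = v ∧ u.2 = v')
      simp only [h, if_false, add_zero]
      rw [le_div_iff₀ (by positivity)]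
      have e : (#{x : V × V | x.1 = v ∧ x.2 = v'}) = 1 := by
        rw [Finset.card_eq_one]
        refine ⟨(v, v'), ?_⟩
        ext x
        simp [Prod.ext_iff]
      rw [e, Fintype.card_prod, ← hL, Nat.cast_mul, Nat.cast_one, one_mul, ← pow_two] at this
      exact this.le
  calc (∑ x : (Q → V) × (Q → V), tlN x v * tlN x v')
      = ∑ w : Q × Q, ∑ w' : Q × Q, (∑ x : (Q → V) × (Q → V),
      (if tlHom w x = v then (1:ℝ) else 0) * (if tlHom w' x = v' then (1:ℝ) else 0)) := by
        unfold tlN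
        simp_rw [Finset.sum_mul_sum]
        rw [Finset.sum_comm]
        refine Finset.sum_congr rfl fun w _ => ?_
        rw [Finset.sum_comm]
    _ ≤ ∑ w : Q × Q, ∑ w' : Q × Q, (L / (Fintype.card V) ^ 2 + if w = w' then (if v = v' then L / Fintype.card V else 0) else 0) :=
        Finset.sum_le_sum fun w _ => Finset.sum_le_sum fun w' _ => key w w'
    _ = _ := by
        simp_rw [Finset.sum_add_distrib]
        simp only [Finset.sum_ite_eq, Finset.mem_univ, if_true, Finset.sum_const, Finset.card_univ,
          Fintype.card_prod, nsmul_eq_mul, Nat.cast_mul]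
        split_ifs <;> ring

theorem tl_triple (hQ : (Fintype.card V) = 128 * Fintype.card Q ^ 3) (hq : 0 < Fintype.card Q) :
    (1 / 2 ^ 18 : ℝ) * Fintype.card (Fin 3 → (Q → V) × (Q → V)) ≤
    #{ω : Fin 3 → (Q → V) × (Q → V) | ∃ v : V, ∃ w : Fin 3 → Q × Q, ∀ i, tlHom (w i) (ω i) = v} := by
  classical
  set q : ℝ := ((Fintype.card Q : ℕ) : ℝ) with hqd
  have hq1 : (1 : ℝ) ≤ q := by rw [hqd]; exact_mod_cast hq
  have hm : (Fintype.card V : ℝ) = 128 * q ^ 3 := by rw [hQ]; push_cast; rfl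
  set L : ℝ := ((Fintype.card ((Q → V) × (Q → V)) : ℕ) : ℝ) with hL
  have hLp : 0 < L := by rw [hL]; exact_mod_cast Fintype.card_pos
  let N : (Fin 3 → (Q → V) × (Q → V)) → ℝ := fun ω => ∑ v, ∏ i, tlN (ω i) v
  have hS1 : ∑ ω, N ω = L ^ 3 / 2 ^ 14 := by
    have h1 : ∀ v : V, (∑ x : (Q → V) × (Q → V), tlN x v) = L / (128 * q) := by
      intro v
      have := tlN_sum (Q := Q) v
      rw [hm] at this
      rw [eq_div_iff (by positivity)]
      have h3 : q ^ 2 * ((∑ x : (Q → V) × (Q → V), tlN x v) * (128 * q)) = q ^ 2 * L := by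
        rw [← this]; ring
      exact mul_left_cancel₀ (by positivity) h3
    simp only [N]
    rw [Finset.sum_comm]
    have h2 : ∀ v : V, ∑ ω : Fin 3 → (Q → V) × (Q → V), ∏ i, tlN (ω i) v = (L / (128 * q)) ^ 3 := by
      intro v
      rw [← h1 v, Fintype.sum_pow]
    rw [Finset.sum_congr rfl (fun v _ => h2 v)]
    rw [Finset.sum_const, Finset.card_univ, nsmul_eq_mul, hm]
    field_simp
    norm_num
  have hS2 : ∑ ω, N ω ^ 2 ≤ L ^ 3 / 2 ^ 10 := by
    have e : ∑ ω, N ω ^ 2 = ∑ v, ∑ v', (∑ x : (Q → V) × (Q → V), tlN x v * tlN x v') ^ 3 := by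
      simp only [N, pow_two, Finset.sum_mul_sum]
      rw [Finset.sum_comm]
      refine Finset.sum_congr rfl fun v _ => ?_
      rw [Finset.sum_comm]
      refine Finset.sum_congr rfl fun v' _ => ?_
      rw [Fintype.sum_pow]
      refine Finset.sum_congr rfl fun ω _ => ?_
      rw [Finset.prod_mul_distrib]
    rw [e]
    have nn : ∀ (x : (Q → V) × (Q → V)) v, 0 ≤ tlN x v := by
      intro x v
      unfold tlN
      exact Finset.sum_nonneg fun w _ => by split_ifs <;> norm_num
    have b : ∀ v v' : V, (∑ x : (Q → V) × (Q → V), tlN x v * tlN x v') ^ 3 ≤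
        (L / (2 ^ 14 * q ^ 2)) ^ 3 + if v = v' then (L / (64 * q)) ^ 3 else 0 := by
      intro v v'
      have := tlN_sum2 (Q := Q) v v'
      rw [hm, ← hqd, ← hL] at this
      have n0 : 0 ≤ (∑ x : (Q → V) × (Q → V), tlN x v * tlN x v') :=
        Finset.sum_nonneg fun x _ => mul_nonneg (nn _ _) (nn _ _)
      have e1 : q ^ 4 * L / (128 * q ^ 3) ^ 2 = L / (2 ^ 14 * q ^ 2) := by
        field_simp; norm_num
      have e2 : q ^ 2 * L / (128 * q ^ 3) = L / (128 * q) := by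
        field_simp
      rw [e1, e2] at this
      split_ifs at this ⊢
      · have h5 : L / (2 ^ 14 * q ^ 2) ≤ L / (128 * q) := by
          apply div_le_div_of_nonneg_left hLp.le (by positivity)
          nlinarith
        have h6 : L / (64 * q) = L / (128 * q) + L / (128 * q) := by field_simp; norm_num
        have h7 : (∑ x : (Q → V) × (Q → V), tlN x v * tlN x v') ≤ L / (64 * q) := by linarith
        have h8 : 0 ≤ (L / (2 ^ 14 * q ^ 2)) ^ 3 := by positivity
        have := pow_le_pow_left₀ n0 h7 3
        linarith
      · rw [add_zero] at *
        exact pow_le_pow_left₀ n0 this 3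
    refine (Finset.sum_le_sum fun v _ => Finset.sum_le_sum fun v' _ => b v v').trans ?_
    simp_rw [Finset.sum_add_distrib]
    simp only [Finset.sum_ite_eq, Finset.mem_univ, if_true, Finset.sum_const, Finset.card_univ,
          nsmul_eq_mul, hm]
    have : 128 * q ^ 3 * (128 * q ^ 3 * (L / (2 ^ 14 * q ^ 2)) ^ 3) + 128 * q ^ 3 * (L / (64 * q)) ^ 3
      = L ^ 3 * (1 / 2 ^ 28 + 1 / 2 ^ 11) := by
      field_simp
      norm_num
    rw [this]
    have : 0 < L ^ 3 := by positivity
    nlinarith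
  have h := tl_second_moment N
  rw [hS1] at h
  have hsub : #{ω | N ω ≠ 0} ≤ #{ω : Fin 3 → (Q → V) × (Q → V) | ∃ v : V, ∃ w : Fin 3 → Q × Q, ∀ i, tlHom (w i) (ω i) = v} := by
    apply Finset.card_le_card
    intro ω
    simp only [Finset.mem_filter, Finset.mem_univ, true_and]
    intro hN
    obtain ⟨v, _, hv⟩ := Finset.exists_ne_zero_of_sum_ne_zero hN
    rw [Finset.prod_ne_zero_iff] at hv
    have : ∀ i, ∃ w : Q × Q, tlHom w (ω i) = v := by
      intro i
      obtain ⟨w, _, hw⟩ := Finset.exists_ne_zero_of_sum_ne_zero (hv i (Finset.mem_univ _))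
      refine ⟨w, ?_⟩
      by_contra hc
      simp [hc] at hw
    choose w hw using this
    exact ⟨v, w, hw⟩
  have hcard : (Fintype.card (Fin 3 → (Q → V) × (Q → V)) : ℝ) = L ^ 3 := by
    rw [Fintype.card_fun]; push_cast; simp [hL]
  rw [hcard]
  refine le_trans ?_ (Nat.cast_le.mpr hsub)
  have h3 : (L ^ 3 / 2 ^ 14) ^ 2 ≤ (#{ω | N ω ≠ 0} : ℝ) * (L ^ 3 / 2 ^ 10) :=
    h.trans (mul_le_mul_of_nonneg_left hS2 (Nat.cast_nonneg _))
  have hp : 0 < L ^ 3 := by positivity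
  have h4 : L ^ 3 * (L ^ 3 / 2 ^ 18) ≤ L ^ 3 * (#{ω | N ω ≠ 0} : ℝ) := by
    nlinarith
  have := le_of_mul_le_mul_left h4 hp
  linarith

end

theorem tl_coll {A V : Type} [Fintype A] [DecidableEq A] [Fintype V] [DecidableEq V] (s : ℕ) (hs : 0 < s)
    (hA : Fintype.card A = 2 * s) (hV : Fintype.card V = 16 * s ^ 3) :
    (1 / (32 * s) : ℝ) * Fintype.card (A → V) ≤ #{f : A → V | ¬ Function.Injective f} := by
  have h1 : #{f : A → V | Function.Injective f} = (16 * s ^ 3).descFactorial (2 * s) := by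
    rw [← hA, ← hV, ← Fintype.card_embedding_eq, ← Fintype.card_subtype]
    exact Fintype.card_congr (Equiv.subtypeInjectiveEquivEmbedding A V)
  have h2 := Finset.card_filter_add_card_filter_not (s := (Finset.univ : Finset (A → V))) (fun f => Function.Injective f)
  rw [Finset.card_univ] at h2
  have h2' : (#{f : A → V | Function.Injective f} : ℝ) + #{f : A → V | ¬ Function.Injective f} = Fintype.card (A → V) := by
    exact_mod_cast h2
  have hsm : s ≤ 16 * s ^ 3 := by nlinarith [Nat.pow_le_pow_right hs (show 1 ≤ 3 by norm_num), pow_one s]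
  have h3 : (16 * s ^ 3).descFactorial (2 * s) ≤ (16 * s ^ 3) ^ s * (16 * s ^ 3 - s) ^ s := by
    rw [← Nat.descFactorial_mul_descFactorial (show s ≤ 2 * s by omega), mul_comm]
    have : 2 * s - s = s := by omega
    rw [this]
    exact Nat.mul_le_mul (Nat.descFactorial_le_pow _ _) (Nat.descFactorial_le_pow _ _)
  have hs' : (1 : ℝ) ≤ s := by exact_mod_cast hs
  have h4 : ((16 * s ^ 3).descFactorial (2 * s) : ℝ) ≤ (16 * (s:ℝ) ^ 3) ^ s * (16 * (s:ℝ) ^ 3 - s) ^ s := by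
    have := (Nat.cast_le (α := ℝ)).mpr h3
    push_cast [Nat.cast_sub hsm] at this
    exact this
  have hc : (Fintype.card (A → V) : ℝ) = (16 * (s:ℝ) ^ 3) ^ s * (16 * (s:ℝ) ^ 3) ^ s := by
    rw [Fintype.card_fun, hA, hV]; push_cast; rw [two_mul, pow_add]
  set M : ℝ := 16 * (s:ℝ) ^ 3 with hM
  have hMp : 0 < M := by positivity
  set x : ℝ := 1 / (16 * (s:ℝ) ^ 2) with hx
  have hx0 : 0 < x := by positivity
  have hx1 : x ≤ 1 := by
    rw [hx, div_le_one (by positivity)]; nlinarith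
  have h5 : M - s = M * (1 - x) := by
    rw [hM, hx]; field_simp
  have h6 : (1 - x) ^ s * (1 + s * x) ≤ 1 := by
    have hb := one_add_mul_le_pow (show (-2 : ℝ) ≤ x by linarith) s
    calc (1 - x) ^ s * (1 + s * x) ≤ (1 - x) ^ s * (1 + x) ^ s := by
          apply mul_le_mul_of_nonneg_left hb (pow_nonneg (by linarith) _)
      _ = ((1 - x) * (1 + x)) ^ s := by rw [mul_pow]
      _ ≤ 1 := pow_le_one₀ (by nlinarith) (by nlinarith)
  have h7 : (1 - x) ^ s ≤ 1 - 1 / (32 * s) := by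
    have hsx : (s:ℝ) * x = 1 / (16 * s) := by rw [hx]; field_simp
    rw [hsx] at h6
    have h0 : 0 ≤ (1 - x) ^ s := pow_nonneg (by linarith) _
    set t : ℝ := 1 / (32 * s) with ht
    have ht2 : 1 / (16 * (s:ℝ)) = 2 * t := by rw [ht]; field_simp; norm_num
    have ht0 : 0 < t := by positivity
    have ht1 : t ≤ 1 / 2 := by
      rw [ht, div_le_div_iff₀ (by positivity) (by norm_num)]; linarith
    rw [ht2] at h6
    by_contra hcon
    push Not at hcon
    nlinarith
  rw [h1] at h2'
  rw [h5, mul_pow M] at h4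
  rw [hc] at h2' ⊢
  have hP : 0 < M ^ s * M ^ s := by positivity
  have := mul_le_mul_of_nonneg_left h7 hP.le
  nlinarith

theorem tl_fail {b : ℕ} {A Q : Type} (e : Fin 3 → Q → A)
    (he : ∀ i j x y, e i x = e j y → i = j)
    (T₀ T₁ : Fin 3 → A → (Fin b → ZMod 2)) (a : Fin 2 → A) (ha : Function.Injective a)
    (hT : T₁ 0 (a 0) = T₁ 0 (a 1)) (v : Fin b → ZMod 2) (w : Fin 3 → Q × Q)
    (hw : ∀ i, T₀ 1 (e i (w i).1) + T₀ 2 (e i (w i).2) = v) (S : Finset (Fin 3 → A))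
    (hS : ∀ x, x ∈ S) :
    ¬ CuckooSucceeds S (tabHash T₀) (tabHash T₁) := by
  rintro ⟨f, hinj, hf⟩
  let key : Fin 2 × Fin 3 → (Fin 3 → A) := fun p => ![a p.1, e p.2 (w p.2).1, e p.2 (w p.2).2]
  have hkey : Function.Injective key := by
    rintro ⟨s, i⟩ ⟨s', i'⟩ h
    have h0 := congrFun h 0
    have h1 := congrFun h 1
    simp [key] at h0 h1
    rw [ha h0, he _ _ _ _ h1]
  let g : Fin 2 ⊕ Fin 3 → Fin 2 × (Fin b → ZMod 2) := fun
    | .inl s => (0, T₀ 0 (a s) + v)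
    | .inr i => (1, T₁ 0 (a 0) + T₁ 1 (e i (w i).1) + T₁ 2 (e i (w i).2))
  have hg : ∀ p, ∃ t, f (key p) = g t := by
    rintro ⟨s, i⟩
    rcases hf (key (s, i)) (hS _) with h | h
    · refine ⟨.inl s, ?_⟩
      rw [h]
      simp [g, key, tabHash, Fin.sum_univ_three, ← hw i, add_assoc]
    · refine ⟨.inr i, ?_⟩
      rw [h]
      have : T₁ 0 (a s) = T₁ 0 (a 0) := by
        fin_cases s
        · rfl
        · exact hT.symm
      simp [g, key, tabHash, Fin.sum_univ_three, this]
  choose t ht using hg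
  have htinj : Function.Injective t := by
    intro p p' h
    apply hkey
    apply hinj (hS _) (hS _)
    rw [ht, ht, h]
  have := Fintype.card_le_of_injective t htinj
  simp at this

def tlProj {A Q V : Type} [AddCommGroup V] (e : Fin 3 → Q → A) :
    (Fin 3 → A → V) →+ (Fin 3 → (Q → V) × (Q → V)) where
  toFun T := fun i => (T 1 ∘ e i, T 2 ∘ e i)
  map_zero' := by ext <;> simp
  map_add' x y := by ext <;> simp

def tlProj0 {A V : Type} [AddCommGroup V] : (Fin 3 → A → V) →+ (A → V) where
  toFun T := T 0
  map_zero' := rfl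
  map_add' x y := rfl

theorem tlProj_surj {A Q V : Type} [AddCommGroup V] (e : Fin 3 → Q → A)
    (he : ∀ i j x y, e i x = e j y → i = j ∧ x = y) :
    Function.Surjective (tlProj (V := V) e) := by
  intro ω
  have hE : Function.Injective (fun p : Fin 3 × Q => e p.1 p.2) := by
    rintro ⟨i, x⟩ ⟨j, y⟩ h
    obtain ⟨h1, h2⟩ := he _ _ _ _ h
    exact Prod.ext h1 h2
  refine ⟨![0, Function.extend (fun p : Fin 3 × Q => e p.1 p.2) (fun p => (ω p.1).1 p.2) 0,
    Function.extend (fun p : Fin 3 × Q => e p.1 p.2) (fun p => (ω p.1).2 p.2) 0], ?_⟩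
  funext i
  refine Prod.ext ?_ ?_
  · funext x
    exact hE.extend_apply (fun p => (ω p.1).1 p.2) 0 (i, x)
  · funext x
    exact hE.extend_apply (fun p => (ω p.1).2 p.2) 0 (i, x)

set_option maxHeartbeats 1000000 in
theorem tl_main (k : ℕ) (hk : 2 ≤ k) :
    (1 / 2 ^ 22 : ℝ) * (1 / 2 ^ k) ≤ tabPr2 3 (3 * k + 1) (Fin (2 ^ k)) (fun T₀ T₁ =>
            ¬ CuckooSucceeds (Finset.univ : Finset (Fin 3 → Fin (2 ^ k)))
              (tabHash T₀) (tabHash T₁)) := by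
  classical
  obtain ⟨l, rfl⟩ := Nat.exists_eq_add_of_le hk
  let A := Fin (2 ^ (2 + l))
  let Q := Fin (2 ^ l)
  let V := Fin (3 * (2 + l) + 1) → ZMod 2
  have hr : 2 ^ (2 + l) = 4 * 2 ^ l := by rw [pow_add]; norm_num
  have hlp : 0 < 2 ^ l := by positivity
  let e : Fin 3 → Q → A := fun i x => ⟨i.1 * 2 ^ l + x.1, by
    have h1 := i.2
    have h2 := x.2
    rw [hr]; nlinarith⟩
  have he : ∀ i j x y, e i x = e j y → i = j ∧ x = y := by
    intro i j x y h
    have h1 : i.1 * 2 ^ l + x.1 = j.1 * 2 ^ l + y.1 := congrArg Fin.val h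
    have hx := x.2
    have hy := y.2
    have hij : i.1 = j.1 := by
      have := congrArg (· / 2 ^ l) h1
      rwa [mul_comm, Nat.mul_add_div hlp, Nat.div_eq_of_lt hx, mul_comm, Nat.mul_add_div hlp,
        Nat.div_eq_of_lt hy] at this
    refine ⟨Fin.ext hij, Fin.ext ?_⟩
    rw [hij] at h1
    omega
  have hcV : Fintype.card V = 128 * (2 ^ l) ^ 3 := by
    simp only [V, Fintype.card_fun, ZMod.card, Fintype.card_fin]
    ring
  have t1 := tl_triple (Q := Q) (V := V) (by simp only [Q, Fintype.card_fin]; exact hcV)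
    (by simp only [Q, Fintype.card_fin]; exact hlp)
  have t2 := tl_coll (A := A) (V := V) (2 ^ (l + 1)) (by positivity)
    (by simp only [A, Fintype.card_fin]; ring) (by rw [hcV]; ring)
  have c1 := tl_card_pre (tlProj (V := V) e) (tlProj_surj e he) (fun ω =>
    ∃ v : V, ∃ w : Fin 3 → Q × Q, ∀ i, tlHom (w i) (ω i) = v)
  have c2 := tl_card_pre (tlProj0 (A := A) (V := V)) (fun f => ⟨fun _ => f, rfl⟩)
    (fun f => ¬ Function.Injective f)
  set E0 : Finset (Fin 3 → A → V) := {T | ∃ v : V, ∃ w : Fin 3 → Q × Q, ∀ i, tlHom (w i) (tlProj e T i) = v} with hE0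
  set E1 : Finset (Fin 3 → A → V) := {T | ¬ Function.Injective (tlProj0 T)} with hE1
  set G : ℝ := ((Fintype.card (Fin 3 → A → V) : ℕ) : ℝ) with hG
  have hGp : 0 < G := by rw [hG]; exact_mod_cast Fintype.card_pos
  have d1 : (1 / 2 ^ 18 : ℝ) * G ≤ #E0 := by
    have hp : (0 : ℝ) < Fintype.card (Fin 3 → (Q → V) × (Q → V)) := by exact_mod_cast Fintype.card_pos
    refine le_of_mul_le_mul_right ?_ hp
    rw [c1]
    have := mul_le_mul_of_nonneg_right t1 hGp.le
    linarith
  have d2 : (1 / (16 * 2 ^ (2 + l)) : ℝ) * G ≤ #E1 := by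
    have hp : (0 : ℝ) < Fintype.card (A → V) := by exact_mod_cast Fintype.card_pos
    refine le_of_mul_le_mul_right ?_ hp
    rw [c2]
    have := mul_le_mul_of_nonneg_right t2 hGp.le
    have e3 : (1 / (32 * ((2 ^ (l + 1) : ℕ) : ℝ)) : ℝ) = 1 / (16 * 2 ^ (2 + l)) := by
      push_cast
      rw [pow_add, pow_add]
      congr 1
      ring
    rw [e3] at this
    linarith
  unfold tabPr2
  rw [Nat.card_prod]
  have e4 : (Nat.card (Fin 3 → Fin (2 ^ (2 + l)) → Fin (3 * (2 + l) + 1) → ZMod 2) : ℝ) = G := by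
    rw [hG, Nat.card_eq_fintype_card]
  push_cast
  rw [e4, le_div_iff₀ (by positivity)]
  have hsub : #(E0 ×ˢ E1) ≤ Nat.card {p : (Fin 3 → A → V) × (Fin 3 → A → V) //
      ¬ CuckooSucceeds (Finset.univ : Finset (Fin 3 → A)) (tabHash p.1) (tabHash p.2)} := by
    rw [Nat.card_eq_fintype_card, Fintype.card_subtype]
    apply Finset.card_le_card
    rintro ⟨T₀, T₁⟩ hT
    rw [Finset.mem_product] at hT
    obtain ⟨h0, h1⟩ := hT
    simp only [hE0, hE1, Finset.mem_filter, Finset.mem_univ, true_and] at h0 h1 ⊢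
    obtain ⟨v, w, hw⟩ := h0
    simp only [Function.Injective, not_forall] at h1
    obtain ⟨a, a', haa, hne⟩ := h1
    refine tl_fail e (fun i j x y h => (he i j x y h).1) T₀ T₁ ![a, a'] ?_ ?_ v w ?_ _
      (fun x => Finset.mem_univ x)
    · intro i j h
      fin_cases i <;> fin_cases j <;> simp_all
    · exact haa
    · intro i
      exact hw i
  have hsub' := (Nat.cast_le (α := ℝ)).mpr hsub
  rw [Finset.card_product] at hsub'
  push_cast at hsub'
  refine le_trans ?_ hsub'
  clear_value G
  have hn1 : (0 : ℝ) ≤ 1 / (16 * 2 ^ (2 + l)) * G := mul_nonneg (by positivity) hGp.le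
  refine le_trans (le_of_eq ?_) (mul_le_mul d1 d2 hn1 (Nat.cast_nonneg _))
  rw [one_div (16 * _), mul_inv, one_div (2 ^ (2 + l))]
  generalize ((2 : ℝ) ^ (2 + l))⁻¹ = u
  ring

theorem tl_one : 0 < tabPr2 3 (3 * 1 + 1) (Fin (2 ^ 1)) (fun T₀ T₁ =>
            ¬ CuckooSucceeds (Finset.univ : Finset (Fin 3 → Fin (2 ^ 1)))
              (tabHash T₀) (tabHash T₁)) := by
  classical
  unfold tabPr2
  apply div_pos
  · rw [Nat.cast_pos]
    have : Nonempty {p : (Fin 3 → Fin (2 ^ 1) → (Fin (3 * 1 + 1) → ZMod 2)) × (Fin 3 → Fin (2 ^ 1) → (Fin (3 * 1 + 1) → ZMod 2)) //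
      ¬ CuckooSucceeds (Finset.univ : Finset (Fin 3 → Fin (2 ^ 1)))
              (tabHash p.1) (tabHash p.2)} := by
      refine ⟨⟨0, 0⟩, ?_⟩
      rintro ⟨f, hinj, hf⟩
      have hg : ∀ x, ∃ t : Fin 2, f x = (t, 0) := by
        intro x
        rcases hf x (Finset.mem_univ _) with h | h
        · exact ⟨0, by rw [h]; simp [tabHash]⟩
        · exact ⟨1, by rw [h]; simp [tabHash]⟩
      choose t ht using hg
      have htinj : Function.Injective t := by
        intro p p' h
        apply hinj (Finset.mem_coe.mpr (Finset.mem_univ _)) (Finset.mem_coe.mpr (Finset.mem_univ _))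
        rw [ht, ht, h]
      have := Fintype.card_le_of_injective t htinj
      simp at this
    exact Nat.card_pos
  · rw [Nat.cast_pos]
    exact Nat.card_pos

/-- On the 3-dimensional cube (all keys over an alphabet of size `2^k`, with `c = 3`
characters, `n = 2^{3k}` keys and `m = 2^{3k+1}` bins), cuckoo hashing with two
independent simple tabulation hash functions fails with probability `Ω(n^{-1/3})`. -/
theorem simple_tabulation_cuckoo_lower :
    ∃ c₀ : ℝ, 0 < c₀ ∧
      ∀ k : ℕ, 1 ≤ k →
        tabPr2 3 (3 * k + 1) (Fin (2 ^ k)) (fun T₀ T₁ =>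
            ¬ CuckooSucceeds (Finset.univ : Finset (Fin 3 → Fin (2 ^ k)))
              (tabHash T₀) (tabHash T₁)) ≥
          c₀ * ((2 : ℝ) ^ (3 * k)) ^ (-(1 / 3) : ℝ) := by
  refine ⟨min (1 / 2 ^ 22) _, lt_min (by norm_num) tl_one, ?_⟩
  intro k hk
  have hpow : ((2 : ℝ) ^ (3 * k)) ^ (-(1 / 3) : ℝ) = 1 / 2 ^ k := by
    rw [mul_comm, pow_mul, Real.rpow_neg (by positivity), one_div, one_div]
    congr 1
    have := Real.pow_rpow_inv_natCast (x := (2:ℝ) ^ k) (n := 3) (by positivity) (by norm_num)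
    simpa using this
  rw [hpow]
  have hp : (0 : ℝ) ≤ 1 / 2 ^ k := by positivity
  rcases Nat.lt_or_ge k 2 with h | h
  · obtain rfl : k = 1 := by omega
    refine (mul_le_mul_of_nonneg_right (min_le_right _ _) hp).trans ?_
    have := tl_one.le
    refine mul_le_of_le_one_right this (by norm_num)
  · exact (mul_le_mul_of_nonneg_right (min_le_left _ _) hp).trans (tl_main k h)
end
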